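/- Let X = (⊕_{n=1}^∞ ℓ₁ⁿ)_{c₀}. Then the surjective hull 𝒢̄_{c₀}^sur(X) — the set of all T ∈ B(X) for which there exist a Banach space Z and a surjective bounded operator Q : Z → X such that T∘Q lies in the norm closure of the set of operators Z → X factoring through c₀ — is a proper two-sided ideal of B(X) that contains every proper two-sided ideal of B(X); in particular, 𝒢̄_{c₀}^sur(X) is the unique maximal ideal of B(X). -/

import Mathlib

open MeasureTheory Filter Topology

noncomputable section

/-- `ℓ₁ⁿ`, i.e. `ℝⁿ` with the norm `‖a‖₁ = ∑ |aᵢ|`. -/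
abbrev ell1 (n : ℕ) : Type := PiLp 1 (fun _ : Fin n => ℝ)

/-- The `ℓ∞`-sum of the spaces `ℓ₁ⁿ`. -/
abbrev preX : Type := lp (fun n : ℕ => ell1 n) ⊤

/-- The subspace of the `ℓ∞`-sum consisting of sequences with `‖xₙ‖₁ → 0`;
this is the `c₀`-direct sum `X = (⊕ₙ ℓ₁ⁿ)_{c₀}`. -/
def XSub : Submodule ℝ preX where
  carrier := {f | Tendsto (fun n => ‖f n‖) atTop (𝓝 0)}
  zero_mem' := by
    simpa using (tendsto_const_nhds : Tendsto (fun _ : ℕ => (0:ℝ)) atTop (𝓝 0))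
  add_mem' := by
    intro f g hf hg
    have h : Tendsto (fun n => ‖f n‖ + ‖g n‖) atTop (𝓝 0) := by
      simpa using hf.add hg
    refine squeeze_zero (fun n => norm_nonneg _) (fun n => ?_) h
    have : (↑(f + g) : ∀ n, ell1 n) n = f n + g n := by
      rw [lp.coeFn_add]; rfl
    rw [this]
    exact norm_add_le _ _
  smul_mem' := by
    intro c f hf
    have h : Tendsto (fun n => ‖c‖ * ‖f n‖) atTop (𝓝 0) := by
      simpa using hf.const_mul ‖c‖
    refine squeeze_zero (fun n => norm_nonneg _) (fun n => ?_) h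
    have : (↑(c • f) : ∀ n, ell1 n) n = c • f n := by
      rw [lp.coeFn_smul]; rfl
    rw [this, norm_smul]

/-- The Banach space `X = (⊕ₙ ℓ₁ⁿ)_{c₀}`. -/
abbrev Xsp : Type := ↥XSub


/-- The Banach space `c₀` of real sequences converging to `0`, with the sup norm. -/
abbrev c0 : Type := ZeroAtInftyContinuousMap ℕ ℝ

/-- A set of operators on `X` is a two-sided ideal if it contains `0` and is stable under
addition and under composition with arbitrary operators on either side. -/
def IsOperatorIdeal (S : Set (Xsp →L[ℝ] Xsp)) : Prop :=
  (0 : Xsp →L[ℝ] Xsp) ∈ S ∧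
    (∀ T U : Xsp →L[ℝ] Xsp, T ∈ S → U ∈ S → T + U ∈ S) ∧
    (∀ T ∈ S, ∀ U : Xsp →L[ℝ] Xsp, U.comp T ∈ S ∧ T.comp U ∈ S)

/-- The surjective hull `𝒢̄_{c₀}^{sur}(X)`: all operators `T` on `X` such that for some
Banach space `Z` and some surjective bounded operator `Q : Z → X`, the composition `T ∘ Q`
lies in the norm closure of the operators `Z → X` factoring through `c₀`. -/
def SurHull : Set (Xsp →L[ℝ] Xsp) :=
  {T | ∃ (Z : Type) (_ : NormedAddCommGroup Z) (_ : NormedSpace ℝ Z) (_ : CompleteSpace Z)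
      (Q : Z →L[ℝ] Xsp), Function.Surjective Q ∧
      T.comp Q ∈ closure
        {S : Z →L[ℝ] Xsp | ∃ A : Z →L[ℝ] c0, ∃ B : c0 →L[ℝ] Xsp, S = B.comp A}}

/-! ### Basic API for `X` -/

/-- The coordinate map onto the `n`-th block. -/
def coX (n : ℕ) : Xsp →L[ℝ] ell1 n :=
  LinearMap.mkContinuous
    { toFun := fun x => (x : preX) n
      map_add' := fun x y => rfl
      map_smul' := fun c x => rfl } 1 (fun x => by
        rw [one_mul]
        exact lp.norm_apply_le_norm (by simp) (x : preX) n)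

theorem coX_apply (n : ℕ) (x : Xsp) : coX n x = (x : preX) n := rfl

theorem coX_norm_le (n : ℕ) (x : Xsp) : ‖coX n x‖ ≤ ‖x‖ :=
  lp.norm_apply_le_norm (by simp) (x : preX) n

theorem X_norm_le {x : Xsp} {C : ℝ} (hC : 0 ≤ C) (h : ∀ n, ‖coX n x‖ ≤ C) : ‖x‖ ≤ C :=
  lp.norm_le_of_forall_le (f := (x : preX)) hC h

theorem X_ext {x y : Xsp} (h : ∀ n, coX n x = coX n y) : x = y := by
  apply Subtype.ext
  apply lp.ext
  funext n
  exact h n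

theorem coX_tendsto (x : Xsp) : Tendsto (fun n => ‖coX n x‖) atTop (𝓝 0) := x.2

theorem exists_X (f : ∀ n, ell1 n) (hf : Tendsto (fun n => ‖f n‖) atTop (𝓝 0)) :
    ∃ x : Xsp, ∀ n, coX n x = f n := by
  have hb : Memℓp f ⊤ := memℓp_infty hf.bddAbove_range
  exact ⟨⟨⟨f, hb⟩, hf⟩, fun n => rfl⟩

theorem exists_op {E : Type*} [NormedAddCommGroup E] [NormedSpace ℝ E]
    (L : ∀ n, E →ₗ[ℝ] ell1 n) (C : ℝ) (hL : ∀ n e, ‖L n e‖ ≤ C * ‖e‖)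
    (ht : ∀ e, Tendsto (fun n => ‖L n e‖) atTop (𝓝 0)) :
    ∃ R : E →L[ℝ] Xsp, ∀ n e, coX n (R e) = L n e := by
  choose F hF using fun e => exists_X (fun n => L n e) (ht e)
  refine ⟨LinearMap.mkContinuous
    { toFun := F
      map_add' := fun x y => X_ext fun n => by rw [map_add, hF, hF, hF, map_add]
      map_smul' := fun c x => X_ext fun n => by
        rw [map_smul, hF, hF, map_smul]; rfl } C ?_, fun n e => hF e n⟩
  intro e
  refine X_norm_le ((norm_nonneg _).trans (hL 0 e)) fun n => ?_
  have : coX n (F e) = L n e := hF e n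
  exact this ▸ hL n e

instance : CompleteSpace Xsp := by
  have hcl : IsClosed (XSub : Set preX) := by
    rw [← isSeqClosed_iff_isClosed]
    intro u f hu hf
    have : Tendsto (fun n => ‖f n‖) atTop (𝓝 0) := by
      rw [Metric.tendsto_atTop]
      intro ε hε
      obtain ⟨k, hk⟩ := (Metric.tendsto_atTop.1 hf (ε / 2) (by linarith))
      have hk := hk k le_rfl
      rw [dist_eq_norm] at hk
      obtain ⟨N, hN⟩ := Metric.tendsto_atTop.1 (hu k) (ε / 2) (by linarith)
      refine ⟨N, fun n hn => ?_⟩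
      have h1 := hN n hn
      simp only [dist_zero_right, norm_norm] at h1 ⊢
      have h2 : ‖(u k - f) n‖ ≤ ‖u k - f‖ := lp.norm_apply_le_norm (by simp) _ n
      have h3 : (u k - f) n = u k n - f n := by rw [lp.coeFn_sub]; rfl
      rw [h3] at h2
      have h4 := norm_sub_norm_le (f n) (u k n)
      rw [norm_sub_rev] at h4
      linarith
    exact this
  exact hcl.completeSpace_coe

theorem ell1_norm {n : ℕ} (x : ell1 n) : ‖x‖ = ∑ i, |x i| := by
  simp [PiLp.norm_eq_of_L1]

theorem ell1_coord_le {n : ℕ} (x : ell1 n) (i : Fin n) : |x i| ≤ ‖x‖ := by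
  rw [ell1_norm]
  exact Finset.single_le_sum (f := fun i => |x i|) (fun i _ => abs_nonneg _) (Finset.mem_univ i)

/-- Unit vectors of `ℓ₁ⁿ`. -/
def e1 (n : ℕ) (j : Fin n) : ell1 n := WithLp.toLp 1 (Pi.single j 1)

theorem e1_norm (n : ℕ) (j : Fin n) : ‖e1 n j‖ = 1 := by
  rw [ell1_norm, Finset.sum_eq_single j]
  · simp [e1]
  · intro b _ hb; simp [e1, hb]
  · simp

theorem ell1_eq_sum {n : ℕ} (x : ell1 n) : x = ∑ j, x j • e1 n j := by
  ext i
  simp [e1, Pi.single_apply]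

theorem exists_trunc (s : Set ℕ) : ∃ R : Xsp →L[ℝ] Xsp, ∀ n x,
    (n ∈ s → coX n (R x) = coX n x) ∧ (n ∉ s → coX n (R x) = 0) := by
  classical
  obtain ⟨R, hR⟩ := exists_op (E := Xsp)
    (fun n => if n ∈ s then ((coX n : Xsp →L[ℝ] ell1 n) : Xsp →ₗ[ℝ] ell1 n) else 0) 1
    (fun n e => by
      split_ifs
      · simpa using coX_norm_le n e
      · simp)
    (fun e => by
      refine squeeze_zero (fun _ => norm_nonneg _) (fun n => ?_) (coX_tendsto e)
      split_ifs
      · exact le_rfl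
      · simp)
  refine ⟨R, fun n x => ⟨fun h => ?_, fun h => ?_⟩⟩
  · rw [hR]; simp [h]
  · rw [hR]; simp [h]

/-- Restriction of `x` to the blocks in `s`. -/
def trunc (s : Set ℕ) : Xsp →L[ℝ] Xsp := (exists_trunc s).choose

theorem trunc_mem {s : Set ℕ} {n : ℕ} (h : n ∈ s) (x : Xsp) : coX n (trunc s x) = coX n x :=
  ((exists_trunc s).choose_spec n x).1 h

theorem trunc_not_mem {s : Set ℕ} {n : ℕ} (h : n ∉ s) (x : Xsp) : coX n (trunc s x) = 0 :=
  ((exists_trunc s).choose_spec n x).2 h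

theorem trunc_norm_le (s : Set ℕ) (x : Xsp) : ‖trunc s x‖ ≤ ‖x‖ := by
  refine X_norm_le (norm_nonneg _) fun n => ?_
  by_cases h : n ∈ s
  · rw [trunc_mem h]; exact coX_norm_le n x
  · rw [trunc_not_mem h]; simp

theorem trunc_tendsto (x : Xsp) : Tendsto (fun N => trunc (Set.Iio N) x) atTop (𝓝 x) := by
  rw [Metric.tendsto_atTop]
  intro ε hε
  obtain ⟨N, hN⟩ := Metric.tendsto_atTop.1 (coX_tendsto x) (ε / 2) (by linarith)
  refine ⟨N, fun M hM => ?_⟩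
  rw [dist_eq_norm]
  refine lt_of_le_of_lt (X_norm_le (C := ε / 2) (by linarith) fun n => ?_) (by linarith)
  rw [map_sub]
  by_cases h : n ∈ Set.Iio M
  · rw [trunc_mem h]; simp; linarith
  · rw [trunc_not_mem h]
    have := hN n (hM.trans (not_lt.1 h))
    simp at this ⊢
    linarith

theorem exists_eX (n : ℕ) (j : Fin n) : ∃ x : Xsp, coX n x = e1 n j ∧ ∀ m, m ≠ n → coX m x = 0 := by
  classical
  obtain ⟨x, hx⟩ := exists_X (Pi.single n (e1 n j)) (by
    refine tendsto_const_nhds.congr' ?_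
    filter_upwards [eventually_gt_atTop n] with m hm
    rw [Pi.single_eq_of_ne hm.ne']; simp)
  refine ⟨x, by rw [hx]; simp, fun m hm => by rw [hx, Pi.single_eq_of_ne hm]⟩

/-- Unit vectors of `X`. -/
def eX (n : ℕ) (j : Fin n) : Xsp := (exists_eX n j).choose

theorem eX_self (n : ℕ) (j : Fin n) : coX n (eX n j) = e1 n j := (exists_eX n j).choose_spec.1

theorem eX_ne {n m : ℕ} (h : m ≠ n) (j : Fin n) : coX m (eX n j) = 0 :=
  (exists_eX n j).choose_spec.2 m h

theorem eX_norm_le (n : ℕ) (j : Fin n) : ‖eX n j‖ ≤ 1 := by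
  refine X_norm_le zero_le_one fun m => ?_
  by_cases h : m = n
  · subst h; rw [eX_self, e1_norm]
  · rw [eX_ne h]; simp

theorem trunc_singleton (n : ℕ) (x : Xsp) :
    trunc {n} x = ∑ j, coX n x j • eX n j := by
  refine X_ext fun m => ?_
  rw [map_sum]
  by_cases h : m = n
  · subst h
    rw [trunc_mem (Set.mem_singleton m)]
    simp only [map_smul, eX_self]
    exact ell1_eq_sum _
  · rw [trunc_not_mem (s := {n}) h]
    simp [eX_ne h]

theorem trunc_Iio (N : ℕ) (x : Xsp) :
    trunc (Set.Iio N) x = ∑ n ∈ Finset.range N, ∑ j, coX n x j • eX n j := by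
  simp_rw [← trunc_singleton]
  refine X_ext fun m => ?_
  rw [map_sum]
  by_cases h : m < N
  · rw [trunc_mem (s := Set.Iio N) h, Finset.sum_eq_single m]
    · rw [trunc_mem (Set.mem_singleton m)]
    · intro b _ hb; exact trunc_not_mem (fun h => hb h.symm) x
    · intro h'; simp at h'; omega
  · rw [trunc_not_mem (s := Set.Iio N) h, Finset.sum_eq_zero]
    intro b hb
    refine trunc_not_mem (fun h' => ?_) x
    simp at hb h'; omega

/-! ### Operators into `c₀` -/

theorem c0_norm_le {u : c0} {C : ℝ} (hC : 0 ≤ C) (h : ∀ k, |u k| ≤ C) : ‖u‖ ≤ C := by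
  rw [← ZeroAtInftyContinuousMap.norm_toBCF_eq_norm]
  exact (BoundedContinuousFunction.norm_le hC).2 h

theorem c0_coord_le (u : c0) (k : ℕ) : |u k| ≤ ‖u‖ := by
  rw [← ZeroAtInftyContinuousMap.norm_toBCF_eq_norm]
  exact u.toBCF.norm_coe_le_norm k

theorem c0_tendsto (u : c0) : Tendsto u atTop (𝓝 0) := by
  have := u.zero_at_infty'
  rwa [Filter.cocompact_eq_cofinite, Nat.cofinite_eq_atTop] at this

theorem exists_c0 (f : ℕ → ℝ) (hf : Tendsto f atTop (𝓝 0)) : ∃ u : c0, ∀ k, u k = f k := by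
  refine ⟨⟨⟨f, continuous_of_discreteTopology⟩, ?_⟩, fun k => rfl⟩
  rw [Filter.cocompact_eq_cofinite, Nat.cofinite_eq_atTop]
  exact hf

theorem exists_opc0 {E : Type*} [NormedAddCommGroup E] [NormedSpace ℝ E]
    (L : ℕ → E →ₗ[ℝ] ℝ) (C : ℝ) (hL : ∀ n e, |L n e| ≤ C * ‖e‖)
    (ht : ∀ e, Tendsto (fun n => L n e) atTop (𝓝 0)) :
    ∃ R : E →L[ℝ] c0, ∀ n e, R e n = L n e := by
  choose F hF using fun e => exists_c0 (fun n => L n e) (ht e)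
  refine ⟨LinearMap.mkContinuous
    { toFun := F
      map_add' := fun x y => by ext n; simp [hF]
      map_smul' := fun c x => by ext n; simp [hF] } C ?_, fun n e => hF e n⟩
  intro e
  refine c0_norm_le ((abs_nonneg _).trans (hL 0 e)) fun n => ?_
  have : F e n = L n e := hF e n
  exact this ▸ hL n e

/-- Evaluation functional on `c₀`. -/
def ev0 (k : ℕ) : c0 →ₗ[ℝ] ℝ where
  toFun u := u k
  map_add' _ _ := rfl
  map_smul' _ _ := rfl



/-! ### The surjective hull is an ideal -/

theorem factor_add {Z : Type} [NormedAddCommGroup Z] [NormedSpace ℝ Z]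
    (A₁ A₂ : Z →L[ℝ] c0) (B₁ B₂ : c0 →L[ℝ] Xsp) :
    ∃ A : Z →L[ℝ] c0, ∃ B : c0 →L[ℝ] Xsp, B₁.comp A₁ + B₂.comp A₂ = B.comp A := by
  obtain ⟨A, hA⟩ := exists_opc0 (E := Z)
    (fun n => if n % 2 = 0 then (ev0 (n / 2)).comp (A₁ : Z →ₗ[ℝ] c0)
      else (ev0 (n / 2)).comp (A₂ : Z →ₗ[ℝ] c0)) (‖A₁‖ + ‖A₂‖)
    (fun n z => by
      have h1 := A₁.le_opNorm z
      have h2 := A₂.le_opNorm z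
      have n1 := norm_nonneg (A₁ z)
      have n2 := norm_nonneg (A₂ z)
      split_ifs
      · have := c0_coord_le (A₁ z) (n / 2)
        change |A₁ z (n / 2)| ≤ _
        nlinarith
      · have := c0_coord_le (A₂ z) (n / 2)
        change |A₂ z (n / 2)| ≤ _
        nlinarith)
    (fun z => by
      have hd : Tendsto (fun n : ℕ => n / 2) atTop atTop :=
        Nat.tendsto_div_const_atTop (by norm_num)
      have h1 := ((c0_tendsto (A₁ z)).comp hd).abs
      have h2 := ((c0_tendsto (A₂ z)).comp hd).abs
      have h := h1.add h2
      simp only [abs_zero, add_zero] at h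
      refine squeeze_zero_norm (fun n => ?_) h
      have n1 := abs_nonneg (A₁ z (n / 2))
      have n2 := abs_nonneg (A₂ z (n / 2))
      split_ifs
      · change |A₁ z (n / 2)| ≤ |A₁ z (n / 2)| + |A₂ z (n / 2)|
        linarith
      · change |A₂ z (n / 2)| ≤ |A₁ z (n / 2)| + |A₂ z (n / 2)|
        linarith)
  have key : ∀ r : ℕ, r < 2 → ∃ D : c0 →L[ℝ] c0, ∀ n u, D u n = u (2 * n + r) := by
    intro r _
    obtain ⟨D, hD⟩ := exists_opc0 (E := c0) (fun n => ev0 (2 * n + r)) 1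
      (fun n u => by rw [one_mul]; exact c0_coord_le u _)
      (fun u => (c0_tendsto u).comp
        (tendsto_atTop_mono (fun n => by simp only [id]; omega) (tendsto_id (α := ℕ))))
    exact ⟨D, hD⟩
  obtain ⟨D₁, hD₁⟩ := key 0 (by norm_num)
  obtain ⟨D₂, hD₂⟩ := key 1 (by norm_num)
  refine ⟨A, B₁.comp D₁ + B₂.comp D₂, ?_⟩
  ext1 z
  have e1 : D₁ (A z) = A₁ z := by
    ext n
    rw [hD₁, hA]
    have h1 : (2 * n + 0) % 2 = 0 := by omega
    have h2 : (2 * n + 0) / 2 = n := by omega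
    rw [if_pos h1, h2]; rfl
  have e2 : D₂ (A z) = A₂ z := by
    ext n
    rw [hD₂, hA]
    have h1 : ¬ (2 * n + 1) % 2 = 0 := by omega
    have h2 : (2 * n + 1) / 2 = n := by omega
    rw [if_neg h1, h2]; rfl
  simp [e1, e2]

/-- The pullback of two operators with the same target. -/
def pullb {Z W V : Type} [NormedAddCommGroup Z] [NormedSpace ℝ Z] [NormedAddCommGroup W]
    [NormedSpace ℝ W] [NormedAddCommGroup V] [NormedSpace ℝ V]
    (P : Z →L[ℝ] V) (Q : W →L[ℝ] V) : Submodule ℝ (Z × W) :=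
  LinearMap.ker ((P.comp (ContinuousLinearMap.fst ℝ Z W) -
    Q.comp (ContinuousLinearMap.snd ℝ Z W) : Z × W →L[ℝ] V) : Z × W →ₗ[ℝ] V)

theorem mem_pullb {Z W V : Type} [NormedAddCommGroup Z] [NormedSpace ℝ Z] [NormedAddCommGroup W]
    [NormedSpace ℝ W] [NormedAddCommGroup V] [NormedSpace ℝ V]
    (P : Z →L[ℝ] V) (Q : W →L[ℝ] V) (x : Z × W) : x ∈ pullb P Q ↔ P x.1 = Q x.2 := by
  simp [pullb, sub_eq_zero]

theorem exists_pullback {Z W V : Type} [NormedAddCommGroup Z] [NormedSpace ℝ Z]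
    [NormedAddCommGroup W] [NormedSpace ℝ W] [NormedAddCommGroup V] [NormedSpace ℝ V]
    [CompleteSpace Z] [CompleteSpace W] (P : Z →L[ℝ] V) (Q : W →L[ℝ] V) :
    ∃ (E : Type) (_ : NormedAddCommGroup E) (_ : NormedSpace ℝ E) (_ : CompleteSpace E)
      (p₁ : E →L[ℝ] Z) (p₂ : E →L[ℝ] W), (∀ e, P (p₁ e) = Q (p₂ e)) ∧
      ∀ z w, P z = Q w → ∃ e, p₁ e = z ∧ p₂ e = w := by
  have : IsClosed (pullb P Q : Set (Z × W)) := ContinuousLinearMap.isClosed_ker _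
  refine ⟨pullb P Q, inferInstance, inferInstance, this.completeSpace_coe,
    (ContinuousLinearMap.fst ℝ Z W).comp (pullb P Q).subtypeL,
    (ContinuousLinearMap.snd ℝ Z W).comp (pullb P Q).subtypeL,
    fun e => (mem_pullb P Q _).1 e.2, fun z w h => ⟨⟨(z, w), (mem_pullb P Q _).2 h⟩, rfl, rfl⟩⟩

theorem factor_precomp {Z W : Type} [NormedAddCommGroup Z] [NormedSpace ℝ Z]
    [NormedAddCommGroup W] [NormedSpace ℝ W] (P : W →L[ℝ] Z) {S : Z →L[ℝ] Xsp}
    (hS : S ∈ closure {S : Z →L[ℝ] Xsp | ∃ A : Z →L[ℝ] c0, ∃ B : c0 →L[ℝ] Xsp, S = B.comp A}) :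
    S.comp P ∈ closure
      {S : W →L[ℝ] Xsp | ∃ A : W →L[ℝ] c0, ∃ B : c0 →L[ℝ] Xsp, S = B.comp A} := by
  refine map_mem_closure (f := fun S : Z →L[ℝ] Xsp => S.comp P) (by fun_prop) hS ?_
  rintro _ ⟨A, B, rfl⟩
  exact ⟨A.comp P, B, rfl⟩

theorem surHull_ideal : IsOperatorIdeal SurHull := by
  refine ⟨?_, ?_, ?_⟩
  · refine ⟨Xsp, inferInstance, inferInstance, inferInstance, ContinuousLinearMap.id ℝ Xsp,
      fun x => ⟨x, rfl⟩, subset_closure ⟨0, 0, ?_⟩⟩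
    ext1 x; simp
  · rintro T U ⟨Z, _, _, _, Q, hQ, hT⟩ ⟨W, _, _, _, R, hR, hU⟩
    obtain ⟨E, _, _, _, P1, P2, hP, hP'⟩ := exists_pullback Q R
    refine ⟨E, inferInstance, inferInstance, inferInstance, Q.comp P1, ?_, ?_⟩
    · intro x
      obtain ⟨z, hz⟩ := hQ x
      obtain ⟨w, hw⟩ := hR x
      obtain ⟨e, he, _⟩ := hP' z w (hz.trans hw.symm)
      exact ⟨e, by simp [he, hz]⟩
    · have hE : (T + U).comp (Q.comp P1) = (T.comp Q).comp P1 + (U.comp R).comp P2 := by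
        ext1 x
        simp [hP]
      rw [hE]
      refine map_mem_closure₂ continuous_add (factor_precomp P1 hT) (factor_precomp P2 hU) ?_
      rintro _ ⟨A₁, B₁, rfl⟩ _ ⟨A₂, B₂, rfl⟩
      exact factor_add A₁ A₂ B₁ B₂
  · rintro T ⟨Z, _, _, _, Q, hQ, hT⟩ U
    constructor
    · refine ⟨Z, inferInstance, inferInstance, inferInstance, Q, hQ, ?_⟩
      refine map_mem_closure (f := fun S : Z →L[ℝ] Xsp => U.comp S) (by fun_prop) hT ?_
      rintro _ ⟨A, B, rfl⟩
      exact ⟨A, U.comp B, rfl⟩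
    · obtain ⟨E, _, _, _, P1, P2, hP, hP'⟩ := exists_pullback Q U
      refine ⟨E, inferInstance, inferInstance, inferInstance, P2, ?_, ?_⟩
      · intro x
        obtain ⟨z, hz⟩ := hQ (U x)
        obtain ⟨e, _, he⟩ := hP' z x hz
        exact ⟨e, he⟩
      · have hE : (T.comp U).comp P2 = (T.comp Q).comp P1 := by
          ext1 x
          simp [hP]
        rw [hE]
        exact factor_precomp P1 hT



/-! ### Khintchine-type inequality and properness -/

theorem khin_aux (K : Finset ℕ) (α β : ℕ → ℝ) (hβ : ∀ k, 0 ≤ β k) (a : ℕ → ℕ → ℝ) (n : ℕ) :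
    ∀ x : ℕ → ℝ, ∃ ε : ℕ → ℝ, (∀ i, |ε i| ≤ 1) ∧
      ∑ k ∈ K, (α k * (x k ^ 2 + ∑ i ∈ Finset.range n, a i k ^ 2) -
        β k * (x k ^ 4 + 6 * x k ^ 2 * (∑ i ∈ Finset.range n, a i k ^ 2) +
          3 * (∑ i ∈ Finset.range n, a i k ^ 2) ^ 2)) ≤
      ∑ k ∈ K, (α k * (x k + ∑ i ∈ Finset.range n, ε i * a i k) ^ 2 -
        β k * (x k + ∑ i ∈ Finset.range n, ε i * a i k) ^ 4) := by
  induction n with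
  | zero =>
    intro x
    exact ⟨fun _ => 0, fun i => by simp, by simp⟩
  | succ n ih =>
    intro x
    have step : ∃ s : ℝ, |s| ≤ 1 ∧
        ∑ k ∈ K, (α k * (x k ^ 2 + ∑ i ∈ Finset.range (n + 1), a i k ^ 2) -
        β k * (x k ^ 4 + 6 * x k ^ 2 * (∑ i ∈ Finset.range (n + 1), a i k ^ 2) +
          3 * (∑ i ∈ Finset.range (n + 1), a i k ^ 2) ^ 2)) ≤
        ∑ k ∈ K, (α k * ((x k + s * a n k) ^ 2 + ∑ i ∈ Finset.range n, a i k ^ 2) -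
        β k * ((x k + s * a n k) ^ 4
          + 6 * (x k + s * a n k) ^ 2 * (∑ i ∈ Finset.range n, a i k ^ 2) +
          3 * (∑ i ∈ Finset.range n, a i k ^ 2) ^ 2)) := by
      by_contra! hcon
      have h1 := hcon 1 (by simp)
      have h2 := hcon (-1) (by simp)
      have h3 := add_lt_add h1 h2
      rw [← Finset.sum_add_distrib, ← Finset.sum_add_distrib] at h3
      refine absurd h3 (not_lt.2 (Finset.sum_le_sum fun k _ => ?_))
      rw [Finset.sum_range_succ]
      set σ := ∑ i ∈ Finset.range n, a i k ^ 2
      have hb : 0 ≤ β k * (a n k) ^ 4 := mul_nonneg (hβ k) (by positivity)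
      nlinarith
    obtain ⟨s, hs, hle⟩ := step
    obtain ⟨ε, hε, hle2⟩ := ih (fun k => x k + s * a n k)
    refine ⟨Function.update ε n s, fun i => ?_, hle.trans (hle2.trans (le_of_eq ?_))⟩
    · by_cases h : i = n
      · subst h; simpa using hs
      · simpa [h] using hε i
    · refine Finset.sum_congr rfl fun k _ => ?_
      have : ∑ i ∈ Finset.range (n + 1), Function.update ε n s i * a i k =
          ∑ i ∈ Finset.range n, ε i * a i k + s * a n k := by
        rw [Finset.sum_range_succ]
        congr 1
        · refine Finset.sum_congr rfl fun i hi => ?_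
          rw [Function.update_of_ne (by simp at hi; omega)]
        · simp
      rw [this]
      ring

theorem poly_abs (t : ℝ) (ht : 0 ≤ t) : 0 ≤ 1 - t + 4 / 27 * t ^ 3 := by
  nlinarith [mul_nonneg (by linarith : 0 ≤ t + 3) (sq_nonneg (t - 3 / 2))]

theorem poly_bound (σ s : ℝ) (hσ : 0 ≤ σ) :
    1 / (2 * σ) * s ^ 2 - 1 / (54 * σ ^ 3) * s ^ 4 ≤ |s| := by
  rcases hσ.eq_or_lt with h | h
  · rw [← h]; simp
  · have h1 := poly_abs (|s| / (2 * σ)) (by positivity)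
    have h2 : |s| - (1 / (2 * σ) * s ^ 2 - 1 / (54 * σ ^ 3) * s ^ 4) =
        |s| * (1 - (|s| / (2 * σ)) + 4 / 27 * (|s| / (2 * σ)) ^ 3) := by
      rw [← sq_abs s, show s ^ 4 = |s| ^ 4 by rw [← abs_pow, abs_of_nonneg (by positivity)]]
      field_simp
      ring
    have := mul_nonneg (abs_nonneg s) h1
    linarith

theorem khin (K : Finset ℕ) (a : ℕ → ℕ → ℝ) (n : ℕ) :
    ∃ ε : ℕ → ℝ, (∀ i, |ε i| ≤ 1) ∧
      4 / 9 * ∑ k ∈ K, ∑ i ∈ Finset.range n, |a i k| ≤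
      √n * ∑ k ∈ K, |∑ i ∈ Finset.range n, ε i * a i k| := by
  set σ : ℕ → ℝ := fun k => √(∑ i ∈ Finset.range n, a i k ^ 2) with hσ
  have hσ0 : ∀ k, 0 ≤ σ k := fun k => Real.sqrt_nonneg _
  have hσ2 : ∀ k, ∑ i ∈ Finset.range n, a i k ^ 2 = σ k ^ 2 := fun k =>
    (Real.sq_sqrt (Finset.sum_nonneg fun i _ => sq_nonneg _)).symm
  obtain ⟨ε, hε, h⟩ := khin_aux K (fun k => 1 / (2 * σ k)) (fun k => 1 / (54 * σ k ^ 3))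
    (fun k => by have := hσ0 k; positivity) a n (fun _ => 0)
  refine ⟨ε, hε, ?_⟩
  have h1 : ∑ k ∈ K, 4 / 9 * σ k ≤ ∑ k ∈ K, |∑ i ∈ Finset.range n, ε i * a i k| := by
    refine le_trans (le_trans (Finset.sum_le_sum fun k _ => ?_) h)
      (Finset.sum_le_sum fun k _ => ?_)
    · rw [hσ2 k]
      rcases (hσ0 k).eq_or_lt with h' | h'
      · rw [← h']; simp
      · apply le_of_eq
        field_simp
        ring
    · simp only [zero_add]
      exact poly_bound _ _ (hσ0 k)
  have h2 : ∀ k, ∑ i ∈ Finset.range n, |a i k| ≤ √n * σ k := by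
    intro k
    apply le_of_sq_le_sq _ (by have := hσ0 k; positivity)
    rw [mul_pow, Real.sq_sqrt (by positivity), ← hσ2]
    have := sq_sum_le_card_mul_sum_sq (s := Finset.range n) (f := fun i => |a i k|)
    simpa using this
  calc 4 / 9 * ∑ k ∈ K, ∑ i ∈ Finset.range n, |a i k| ≤ 4 / 9 * ∑ k ∈ K, √n * σ k := by
        gcongr with k _; exact h2 k
    _ = √n * ∑ k ∈ K, 4 / 9 * σ k := by
        rw [Finset.mul_sum, Finset.mul_sum]
        exact Finset.sum_congr rfl fun k _ => by ring
    _ ≤ _ := by gcongr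

theorem exists_d0 (k : ℕ) : ∃ u : c0, ∀ l, u l = if l = k then 1 else 0 :=
  exists_c0 _ (by
    refine tendsto_const_nhds.congr' ?_
    filter_upwards [eventually_gt_atTop k] with m hm
    rw [if_neg hm.ne'])

/-- Unit vectors of `c₀`. -/
def d0 (k : ℕ) : c0 := (exists_d0 k).choose

theorem d0_apply (k l : ℕ) : d0 k l = if l = k then 1 else 0 := (exists_d0 k).choose_spec l

theorem sum_d0_apply (K : ℕ) (η : ℕ → ℝ) (l : ℕ) :
    (∑ k ∈ Finset.range K, η k • d0 k : c0) l = if l < K then η l else 0 := by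
  have : (∑ k ∈ Finset.range K, η k • d0 k : c0) l = ∑ k ∈ Finset.range K, η k * d0 k l := by
    change ev0 l _ = _
    rw [map_sum]
    rfl
  rw [this]
  simp [d0_apply]

theorem c0_trunc_tendsto (u : c0) :
    Tendsto (fun K => ∑ k ∈ Finset.range K, u k • d0 k) atTop (𝓝 u) := by
  rw [Metric.tendsto_atTop]
  intro ε hε
  obtain ⟨N, hN⟩ := Metric.tendsto_atTop.1 (c0_tendsto u) (ε / 2) (by linarith)
  refine ⟨N, fun M hM => ?_⟩
  rw [dist_eq_norm]
  refine lt_of_le_of_lt (c0_norm_le (C := ε / 2) (by linarith) fun n => ?_) (by linarith)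
  rw [ZeroAtInftyContinuousMap.sub_apply, sum_d0_apply]
  split_ifs with h
  · simp; linarith
  · have := hN n (by omega)
    simp at this ⊢
    linarith

/-- If `B : c₀ → X` approximately hits the unit vectors of the `n`-th block,
then `n` is bounded. -/
theorem c0_block_bound (B : c0 →L[ℝ] Xsp) (c : ℝ) (hc : 0 < c) (n : ℕ)
    (h : ∀ i : Fin n, ∃ u : c0, ‖u‖ ≤ c ∧ 1 / 2 ≤ coX n (B u) i) : √n ≤ 9 * c * ‖B‖ := by
  rcases Nat.eq_zero_or_pos n with h0 | hn
  · subst h0; simp; positivity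
  choose u hu hu' using h
  have hK : ∃ K, ∀ i : Fin n,
      1 / 4 < coX n (B (∑ k ∈ Finset.range K, u i k • d0 k)) i := by
    have : ∀ i : Fin n, ∀ᶠ K in atTop,
        1 / 4 < coX n (B (∑ k ∈ Finset.range K, u i k • d0 k)) i := by
      intro i
      have hcont : Continuous fun v : c0 => coX n (B v) i := by fun_prop
      have ht := (hcont.tendsto (u i)).comp (c0_trunc_tendsto (u i))
      exact ht.eventually (lt_mem_nhds (by linarith [hu' i]))
    exact (eventually_all.2 this).exists
  obtain ⟨K, hK⟩ := hK
  let g : ℕ → ℕ → ℝ := fun i k => if hi : i < n then coX n (B (d0 k)) ⟨i, hi⟩ else 0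
  have hlow : ∀ i ∈ Finset.range n, 1 / (4 * c) ≤ ∑ k ∈ Finset.range K, |g i k| := by
    intro i hi
    simp only [Finset.mem_range] at hi
    have h1 := hK ⟨i, hi⟩
    have h2 : coX n (B (∑ k ∈ Finset.range K, u ⟨i, hi⟩ k • d0 k)) ⟨i, hi⟩ =
        ∑ k ∈ Finset.range K, u ⟨i, hi⟩ k * g i k := by
      simp [g, hi]
    rw [h2] at h1
    have h3 : ∑ k ∈ Finset.range K, u ⟨i, hi⟩ k * g i k ≤
        ∑ k ∈ Finset.range K, c * |g i k| := by
      refine Finset.sum_le_sum fun k _ => ?_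
      refine (le_abs_self _).trans ?_
      rw [abs_mul]
      gcongr
      exact (c0_coord_le _ _).trans (hu _)
    rw [← Finset.mul_sum] at h3
    rw [div_le_iff₀ (by positivity)]
    nlinarith
  obtain ⟨ε, hε, hkh⟩ := khin (Finset.range K) g n
  have hup : ∑ k ∈ Finset.range K, |∑ i ∈ Finset.range n, ε i * g i k| ≤ ‖B‖ := by
    let η : ℕ → ℝ := fun k => SignType.sign (∑ i ∈ Finset.range n, ε i * g i k)
    have hη : ∀ k, |η k| ≤ 1 := by
      intro k
      simp only [η]
      rcases lt_trichotomy (∑ i ∈ Finset.range n, ε i * g i k) 0 with h | h | h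
      · simp [sign_neg h]
      · simp [h]
      · simp [sign_pos h]
    let v : c0 := ∑ k ∈ Finset.range K, η k • d0 k
    have hv : ‖v‖ ≤ 1 := by
      refine c0_norm_le zero_le_one fun l => ?_
      simp only [v]
      rw [sum_d0_apply]
      split_ifs
      · exact hη l
      · simp
    have hBv : ‖coX n (B v)‖ ≤ ‖B‖ := by
      refine (coX_norm_le _ _).trans ((B.le_opNorm v).trans ?_)
      have := norm_nonneg B
      nlinarith
    rw [ell1_norm] at hBv
    refine le_trans ?_ hBv
    have e1 : ∀ k, |∑ i ∈ Finset.range n, ε i * g i k| =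
        ∑ i : Fin n, ε i * (η k * g i k) := by
      intro k
      rw [← sign_mul_self, Finset.sum_range, Finset.mul_sum]
      refine Finset.sum_congr rfl fun i _ => ?_
      simp only [η]
      rw [Finset.sum_range]
      ring
    simp_rw [e1]
    rw [Finset.sum_comm]
    refine Finset.sum_le_sum fun i _ => ?_
    rw [← Finset.mul_sum]
    have e2 : coX n (B v) i = ∑ k ∈ Finset.range K, η k * g i k := by
      simp [v, g]
    rw [e2]
    refine (le_abs_self _).trans ?_
    rw [abs_mul]
    have := abs_nonneg (∑ k ∈ Finset.range K, η k * g i k)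
    nlinarith [hε i]
  have h5 : n * (1 / (4 * c)) ≤ ∑ k ∈ Finset.range K, ∑ i ∈ Finset.range n, |g i k| := by
    rw [Finset.sum_comm]
    have := Finset.card_nsmul_le_sum _ _ _ hlow
    simpa using this
  have h6 : (4 : ℝ) / 9 * (n * (1 / (4 * c))) ≤ √n * ‖B‖ := by
    refine le_trans (le_trans ?_ hkh) ?_
    · gcongr
    · gcongr
  have hsn : (0 : ℝ) < √n := Real.sqrt_pos.2 (by exact_mod_cast hn)
  have hnn : (n : ℝ) = √n * √n := (Real.mul_self_sqrt (by positivity)).symm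
  have h7 : √n * (√n / (9 * c)) ≤ √n * ‖B‖ := by
    refine le_trans (le_of_eq ?_) h6
    conv_rhs => rw [hnn]
    field_simp
  have h8 := le_of_mul_le_mul_left h7 hsn
  rw [div_le_iff₀ (by positivity)] at h8
  linarith

theorem mem_closure_clm {Z Y : Type} [NormedAddCommGroup Z] [NormedSpace ℝ Z]
    [NormedAddCommGroup Y] [NormedSpace ℝ Y] {f : Z →L[ℝ] Y} {s : Set (Z →L[ℝ] Y)} :
    f ∈ closure s ↔ ∀ ε > 0, ∃ g ∈ s, ‖f - g‖ < ε := by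
  rw [Metric.mem_closure_iff]
  simp_rw [dist_eq_norm]

theorem surHull_proper : SurHull ≠ (Set.univ : Set (Xsp →L[ℝ] Xsp)) := by
  intro hEq
  have hid : ContinuousLinearMap.id ℝ Xsp ∈ SurHull := by rw [hEq]; trivial
  obtain ⟨Z, _, _, _, Q, hQ, hcl⟩ := hid
  obtain ⟨C, hC, hpre⟩ := Q.exists_preimage_norm_le hQ
  obtain ⟨S, ⟨A, B, rfl⟩, hd⟩ := mem_closure_clm.1 hcl (1 / (2 * C)) (by positivity)
  have hb : ∀ n : ℕ, √n ≤ 9 * (C * ‖A‖ + 1) * ‖B‖ := by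
    intro n
    refine c0_block_bound B (C * ‖A‖ + 1) (by positivity) n fun i => ?_
    obtain ⟨z, hz, hzn⟩ := hpre (eX n i)
    have hzn' : ‖z‖ ≤ C := hzn.trans (by
      have := eX_norm_le n i
      nlinarith)
    refine ⟨A z, ?_, ?_⟩
    · have := A.le_opNorm z
      have := norm_nonneg A
      nlinarith
    · have h1 := ((ContinuousLinearMap.id ℝ Xsp).comp Q - B.comp A).le_opNorm z
      have h2 : ((ContinuousLinearMap.id ℝ Xsp).comp Q - B.comp A) z = eX n i - B (A z) := by
        simp [hz]
      rw [h2] at h1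
      have h3 : ‖eX n i - B (A z)‖ ≤ 1 / 2 := by
        refine h1.trans ?_
        calc _ ≤ 1 / (2 * C) * C := by gcongr
          _ = 1 / 2 := by field_simp
      have h4 := (ell1_coord_le (coX n (eX n i - B (A z))) i).trans
        ((coX_norm_le n _).trans h3)
      rw [map_sub, eX_self] at h4
      have h5 : (e1 n i - coX n (B (A z))) i = 1 - coX n (B (A z)) i := by simp [e1]
      rw [h5] at h4
      linarith [(abs_le.1 h4).2]
  obtain ⟨n, hn⟩ := exists_nat_gt ((9 * (C * ‖A‖ + 1) * ‖B‖) ^ 2)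
  have h1 := hb n
  have h2 : (√n) ^ 2 ≤ (9 * (C * ‖A‖ + 1) * ‖B‖) ^ 2 := by gcongr
  rw [Real.sq_sqrt (by positivity)] at h2
  linarith



/-! ### Order bounded operators belong to the surjective hull -/

theorem exists_synth {I : Type} {E : Type} [NormedAddCommGroup E] [NormedSpace ℝ E]
    [CompleteSpace E] (v : I → E) (C : ℝ) (hv : ∀ i, ‖v i‖ ≤ C) :
    ∃ Q : lp (fun _ : I => ℝ) 1 →L[ℝ] E, ∀ z, HasSum (fun i => z i • v i) (Q z) := by
  have hn : ∀ z : lp (fun _ : I => ℝ) 1, HasSum (fun i => ‖z i‖) ‖z‖ := fun z => by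
    simpa using lp.hasSum_norm (p := 1) (by simp) z
  have hb : ∀ (z : lp (fun _ : I => ℝ) 1) i, ‖z i • v i‖ ≤ C * ‖z i‖ := fun z i => by
    rw [norm_smul, mul_comm]
    gcongr
    exact hv i
  have hs : ∀ z : lp (fun _ : I => ℝ) 1, Summable fun i => z i • v i := fun z =>
    Summable.of_norm_bounded ((hn z).summable.mul_left C) (hb z)
  refine ⟨LinearMap.mkContinuous
    { toFun := fun z => ∑' i, z i • v i
      map_add' := fun x y => by
        rw [← (hs x).tsum_add (hs y)]
        refine tsum_congr fun i => ?_
        rw [← add_smul]; rfl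
      map_smul' := fun c x => by
        rw [RingHom.id_apply, ← (hs x).tsum_const_smul c]
        refine tsum_congr fun i => ?_
        rw [← smul_assoc]; rfl } C ?_, fun z => (hs z).hasSum⟩
  intro z
  exact tsum_of_norm_bounded ((hn z).mul_left C) (hb z)

theorem hasSum_bound {I : Type} {E : Type} [NormedAddCommGroup E] [NormedSpace ℝ E]
    (v : I → E) (C : ℝ) (hv : ∀ i, ‖v i‖ ≤ C)
    (z : lp (fun _ : I => ℝ) 1) (s : E) (hs : HasSum (fun i => z i • v i) s) :
    ‖s‖ ≤ C * ‖z‖ := by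
  have hn : HasSum (fun i => ‖z i‖) ‖z‖ := by
    simpa using lp.hasSum_norm (p := 1) (by simp) z
  rw [← hs.tsum_eq]
  refine tsum_of_norm_bounded (hn.mul_left C) fun i => ?_
  rw [norm_smul, mul_comm]
  gcongr
  exact hv i

theorem clamp (t g : ℝ) (hg : 0 ≤ g) : ∃ y : ℝ, |y| ≤ 1 ∧ |t - g * y| ≤ max (|t| - g) 0 := by
  by_cases h : |t| ≤ g
  · rcases hg.eq_or_lt with h0 | h0
    · refine ⟨0, by simp, ?_⟩
      rw [← h0] at h
      simp [abs_nonpos_iff.1 h]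
    · refine ⟨t / g, ?_, ?_⟩
      · rw [abs_div, abs_of_pos h0, div_le_one h0]; exact h
      · rw [mul_div_cancel₀ _ h0.ne']; simp
  · push Not at h
    rcases le_total 0 t with ht | ht
    · refine ⟨1, by simp, le_max_of_le_left ?_⟩
      rw [abs_of_nonneg ht] at h ⊢
      rw [abs_of_nonneg (by linarith)]; linarith
    · refine ⟨-1, by simp, le_max_of_le_left ?_⟩
      rw [abs_of_nonpos ht] at h ⊢
      rw [abs_of_nonpos (by linarith)]; linarith

/-- Approximate uniform order boundedness of the components of `T`. -/
def OB (T : Xsp →L[ℝ] Xsp) : Prop :=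
  ∀ ε : ℝ, 0 < ε → ∃ C : ℝ, ∀ m : ℕ, ∃ g : Fin m → ℝ, (∀ i, 0 ≤ g i) ∧ ∑ i, g i ≤ C ∧
    ∀ x : Xsp, ‖x‖ ≤ 1 → ∑ i, max (|coX m (T x) i| - g i) 0 ≤ ε

theorem exists_diag (g : ∀ m : ℕ, Fin m → ℝ) (C : ℝ) (hg : ∀ m i, 0 ≤ g m i)
    (hC : ∀ m, ∑ i, g m i ≤ C) :
    ∃ B : c0 →L[ℝ] Xsp, ∀ m u i, coX m (B u) i = g m i * u (Nat.pair m i) := by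
  let L : ∀ m, c0 →ₗ[ℝ] ell1 m := fun m =>
    { toFun := fun u => WithLp.toLp 1 fun i => g m i * u (Nat.pair m i)
      map_add' := fun u v => by ext i; simp [mul_add]
      map_smul' := fun c u => by ext i; simp; ring }
  have hL : ∀ m u i, L m u i = g m i * u (Nat.pair m i) := fun m u i => rfl
  have hC0 : 0 ≤ C := by simpa using hC 0
  have hbd : ∀ m (u : c0) (D : ℝ), 0 ≤ D → (∀ k, m ≤ k → |u k| ≤ D) → ‖L m u‖ ≤ C * D := by
    intro m u D hD h
    rw [ell1_norm]
    calc ∑ i, |L m u i| ≤ ∑ i, g m i * D := by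
          refine Finset.sum_le_sum fun i _ => ?_
          rw [hL, abs_mul, abs_of_nonneg (hg m i)]
          exact mul_le_mul_of_nonneg_left (h _ (Nat.left_le_pair _ _)) (hg m i)
      _ = (∑ i, g m i) * D := by rw [Finset.sum_mul]
      _ ≤ C * D := mul_le_mul_of_nonneg_right (hC m) hD
  obtain ⟨B, hB⟩ := exists_op L C
    (fun m u => hbd m u ‖u‖ (norm_nonneg _) fun k _ => c0_coord_le u k) (fun u => by
      rw [Metric.tendsto_atTop]
      intro ε hε
      obtain ⟨N, hN⟩ := Metric.tendsto_atTop.1 (c0_tendsto u) (ε / (C + 1)) (by positivity)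
      refine ⟨N, fun m hm => ?_⟩
      have := hbd m u (ε / (C + 1)) (by positivity) (fun k hk => by
        have := hN k (hm.trans hk)
        rw [Real.dist_0_eq_abs] at this
        exact this.le)
      rw [Real.dist_0_eq_abs, abs_norm]
      refine this.trans_lt ?_
      rw [mul_div_assoc', div_lt_iff₀ (by positivity)]
      nlinarith)
  exact ⟨B, fun m u i => by rw [hB]; exact hL m u i⟩

theorem order_approx (g : ∀ m : ℕ, Fin m → ℝ) (hg : ∀ m i, 0 ≤ g m i) (B : c0 →L[ℝ] Xsp)
    (hB : ∀ m u i, coX m (B u) i = g m i * u (Nat.pair m i)) (ε : ℝ) (hε : 0 < ε) (v : Xsp)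
    (hv : ∀ m, ∑ i, max (|coX m v i| - g m i) 0 ≤ ε) :
    ∃ y : c0, ‖y‖ ≤ 1 ∧ ‖v - B y‖ ≤ ε := by
  obtain ⟨M, hM⟩ := Metric.tendsto_atTop.1 (coX_tendsto v) ε hε
  choose w hw hw' using fun (m : ℕ) (i : Fin m) => clamp (coX m v i) (g m i) (hg m i)
  let w2 : ℕ → ℕ → ℝ := fun m i => if h : i < m then w m ⟨i, h⟩ else 0
  have hw2 : ∀ m (i : Fin m), w2 m i = w m i := fun m i => by simp [w2]
  let f : ℕ → ℝ := fun k => if k.unpair.1 < M then w2 k.unpair.1 k.unpair.2 else 0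
  have hf0 : ∀ᶠ k in atTop, f k = 0 := by
    filter_upwards [eventually_ge_atTop ((M + 1) ^ 2)] with k hk
    simp only [f, w2]
    split_ifs with h1 h2
    · exfalso
      have := Nat.pair_lt_max_add_one_sq k.unpair.1 k.unpair.2
      rw [Nat.pair_unpair, max_eq_left h2.le] at this
      have h3 : (k.unpair.1 + 1) ^ 2 ≤ (M + 1) ^ 2 := Nat.pow_le_pow_left (by omega) 2
      omega
    · rfl
    · rfl
  obtain ⟨y, hy⟩ := exists_c0 f (tendsto_const_nhds.congr' (hf0.mono fun k hk => hk.symm))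
  refine ⟨y, c0_norm_le zero_le_one fun k => ?_, ?_⟩
  · rw [hy]
    simp only [f, w2]
    split_ifs
    · exact hw _ _
    · simp
    · simp
  · refine X_norm_le hε.le fun m => ?_
    rw [map_sub, ell1_norm]
    have hval : ∀ i : Fin m, y (Nat.pair m i) = if m < M then w m i else 0 := by
      intro i
      rw [hy]
      simp only [f, Nat.unpair_pair, hw2]
    by_cases hm : m < M
    · refine le_trans (Finset.sum_le_sum fun i _ => ?_) (hv m)
      have : (coX m v - coX m (B y)) i = coX m v i - g m i * w m i := by
        rw [PiLp.sub_apply, hB, hval, if_pos hm]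
      rw [this]
      exact hw' m i
    · have h1 := hM m (not_lt.1 hm)
      rw [Real.dist_0_eq_abs, abs_norm, ell1_norm] at h1
      refine le_trans (Finset.sum_le_sum fun i _ => ?_) h1.le
      rw [PiLp.sub_apply, hB, hval, if_neg hm]
      simp

theorem synth_surj {E : Type} [NormedAddCommGroup E] [NormedSpace ℝ E]
    (Q : lp (fun _ : {x : E // ‖x‖ ≤ 1} => ℝ) 1 →L[ℝ] E)
    (hQ : ∀ z, HasSum (fun i => z i • i.1) (Q z)) : Function.Surjective Q := by
  classical
  intro x
  by_cases hx : x = 0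
  · exact ⟨0, by simp [hx]⟩
  have hxn : ‖x‖ ≠ 0 := norm_ne_zero_iff.2 hx
  let i : {x : E // ‖x‖ ≤ 1} := ⟨‖x‖⁻¹ • x, by simp [norm_smul, hxn]⟩
  refine ⟨lp.single 1 i ‖x‖, ?_⟩
  refine (hQ _).unique ?_
  have := hasSum_single (f := fun j : {x : E // ‖x‖ ≤ 1} =>
      (lp.single 1 i ‖x‖ : lp (fun _ : {x : E // ‖x‖ ≤ 1} => ℝ) 1) j • j.1) i
    (fun j hj => by
      change (lp.single 1 i ‖x‖ : lp (fun _ : {x : E // ‖x‖ ≤ 1} => ℝ) 1) j • j.1 = 0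
      rw [lp.single_apply_ne _ _ _ hj, zero_smul])
  rw [lp.single_apply_self] at this
  have h2 : ‖x‖ • i.1 = x := by
    simp only [i]
    rw [smul_smul, mul_inv_cancel₀ hxn, one_smul]
  rwa [h2] at this

theorem synth_close {E F G : Type} [NormedAddCommGroup E] [NormedSpace ℝ E]
    [NormedAddCommGroup F] [NormedSpace ℝ F] [NormedAddCommGroup G] [NormedSpace ℝ G] {I : Type}
    (T : E →L[ℝ] F) (B : G →L[ℝ] F) (x : I → E) (y : I → G)
    (Q : lp (fun _ : I => ℝ) 1 →L[ℝ] E) (A : lp (fun _ : I => ℝ) 1 →L[ℝ] G)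
    (hQ : ∀ z, HasSum (fun i => z i • x i) (Q z)) (hA : ∀ z, HasSum (fun i => z i • y i) (A z))
    (ε : ℝ) (hε : 0 ≤ ε) (h : ∀ i, ‖T (x i) - B (y i)‖ ≤ ε) :
    ‖T.comp Q - B.comp A‖ ≤ ε := by
  refine ContinuousLinearMap.opNorm_le_bound _ hε fun z => ?_
  refine hasSum_bound (fun i : I => T (x i) - B (y i)) ε h z _ ?_
  have h1 := T.hasSum (hQ z)
  have h2 := B.hasSum (hA z)
  have h3 := h1.sub h2
  simpa [smul_sub] using h3

theorem hull_gen {E F Z : Type} [NormedAddCommGroup E] [NormedSpace ℝ E]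
    [NormedAddCommGroup F] [NormedSpace ℝ F] (T : E →L[ℝ] F)
    [iz : NormedAddCommGroup Z] [jz : NormedSpace ℝ Z] [kz : CompleteSpace Z]
    (Q : Z →L[ℝ] E) (hQ : Function.Surjective Q)
    (h : ∀ ε : ℝ, 0 < ε → ∃ (A : Z →L[ℝ] c0) (B : c0 →L[ℝ] F), ‖T.comp Q - B.comp A‖ ≤ ε) :
    ∃ (Z : Type) (_ : NormedAddCommGroup Z) (_ : NormedSpace ℝ Z) (_ : CompleteSpace Z)
      (Q : Z →L[ℝ] E), Function.Surjective Q ∧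
      T.comp Q ∈ closure
        {S : Z →L[ℝ] F | ∃ A : Z →L[ℝ] c0, ∃ B : c0 →L[ℝ] F, S = B.comp A} := by
  refine ⟨Z, iz, jz, kz, Q, hQ, ?_⟩
  rw [mem_closure_clm]
  intro ε hε
  obtain ⟨A, B, hB⟩ := h (ε / 2) (by linarith)
  exact ⟨B.comp A, ⟨A, B, rfl⟩, lt_of_le_of_lt hB (by linarith)⟩

set_option maxHeartbeats 2000000 in
theorem hull_crit {E F : Type} [NormedAddCommGroup E] [NormedSpace ℝ E] [CompleteSpace E]
    [NormedAddCommGroup F] [NormedSpace ℝ F] (T : E →L[ℝ] F)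
    (h : ∀ ε : ℝ, 0 < ε → ∃ B : c0 →L[ℝ] F, ∀ x : E, ‖x‖ ≤ 1 →
      ∃ y : c0, ‖y‖ ≤ 1 ∧ ‖T x - B y‖ ≤ ε) :
    ∃ (Z : Type) (_ : NormedAddCommGroup Z) (_ : NormedSpace ℝ Z) (_ : CompleteSpace Z)
      (Q : Z →L[ℝ] E), Function.Surjective Q ∧
      T.comp Q ∈ closure
        {S : Z →L[ℝ] F | ∃ A : Z →L[ℝ] c0, ∃ B : c0 →L[ℝ] F, S = B.comp A} := by
  obtain ⟨Q, hQ⟩ := exists_synth (fun x : {x : E // ‖x‖ ≤ 1} => x.1) 1 (fun x => x.2)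
  refine hull_gen T Q (synth_surj Q hQ) fun ε hε => ?_
  obtain ⟨B, hB⟩ := h ε hε
  have hB' : ∀ x : {x : E // ‖x‖ ≤ 1}, ∃ y : c0, ‖y‖ ≤ 1 ∧ ‖T x.1 - B y‖ ≤ ε :=
    fun x => hB x.1 x.2
  choose y hy1 hy2 using hB'
  obtain ⟨A, hA⟩ := exists_synth y 1 hy1
  exact ⟨A, B, synth_close T B (fun x => x.1) y Q A hQ hA ε hε.le hy2⟩

theorem OB_surHull (T : Xsp →L[ℝ] Xsp) (hT : OB T) : T ∈ SurHull := by
  refine hull_crit T fun ε hε => ?_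
  obtain ⟨C, hC⟩ := hT ε hε
  choose g hg hgC hgT using hC
  obtain ⟨B, hB⟩ := exists_diag g C hg hgC
  exact ⟨B, fun x hx => order_approx g hg B hB ε hε (T x) (fun m => hgT m x hx)⟩


theorem select_free (bad : ℕ → ℕ → Prop) [DecidableRel bad] (D : ℕ) : ∀ (k : ℕ) (s : Finset ℕ),
    (∀ r ∈ s, (s.filter (fun l => l < r ∧ bad r l)).card ≤ D) → k * (D + 1) ≤ s.card →
    ∃ F ⊆ s, F.card = k ∧ ∀ r ∈ F, ∀ l ∈ F, l < r → ¬ bad r l := by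
  intro k
  induction k with
  | zero => intro s _ _; exact ⟨∅, by simp, by simp, by simp⟩
  | succ k ih =>
    intro s hs hk
    have hne : s.Nonempty := by
      rw [← Finset.card_pos]
      have : 0 < (k + 1) * (D + 1) := by positivity
      omega
    set r := s.max' hne with hr
    have hrs : r ∈ s := s.max'_mem hne
    set s' := s.filter (fun l => l < r ∧ ¬ bad r l) with hs'
    have hsub : s' ⊆ s := Finset.filter_subset _ _
    have hcov : s ⊆ insert r (s' ∪ s.filter (fun l => l < r ∧ bad r l)) := by
      intro l hl
      have hle : l ≤ r := s.le_max' l hl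
      rcases hle.lt_or_eq with h | h
      · by_cases hb : bad r l
        · simp [hl, h, hb]
        · simp [hs', hl, h, hb]
      · simp [h]
    have hc1 := Finset.card_le_card hcov
    have hc2 := Finset.card_insert_le r (s' ∪ s.filter (fun l => l < r ∧ bad r l))
    have hc3 := Finset.card_union_le s' (s.filter (fun l => l < r ∧ bad r l))
    have hc4 := hs r hrs
    have hk' : k * (D + 1) ≤ s'.card := by
      have : (k + 1) * (D + 1) = k * (D + 1) + D + 1 := by ring
      omega
    obtain ⟨F, hF, hFc, hFb⟩ := ih s' (fun q hq => by
      refine le_trans (Finset.card_le_card ?_) (hs q (hsub hq))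
      exact Finset.filter_subset_filter _ hsub) hk'
    have hlt : ∀ l ∈ F, l < r ∧ ¬ bad r l := fun l hl => (Finset.mem_filter.1 (hF hl)).2
    refine ⟨insert r F, ?_, ?_, ?_⟩
    · exact Finset.insert_subset hrs (hF.trans hsub)
    · rw [Finset.card_insert_of_notMem (fun h => (hlt r h).1.false), hFc]
    · intro a ha b hb hab
      rcases Finset.mem_insert.1 ha with rfl | ha
      · rcases Finset.mem_insert.1 hb with rfl | hb
        · exact absurd hab (lt_irrefl _)
        · exact (hlt b hb).2
      · rcases Finset.mem_insert.1 hb with rfl | hb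
        · exact absurd hab (not_lt.2 (hlt a ha).1.le)
        · exact hFb a ha b hb hab

theorem greedy {m : ℕ} (W : Set (Fin m → ℝ)) (ε M C lam : ℝ) (hl : 0 ≤ lam)
    (hW : ∀ w ∈ W, ∑ i, |w i| ≤ M)
    (h : ∀ g : Fin m → ℝ, (∀ i, 0 ≤ g i) → ∑ i, g i ≤ C →
      ∃ w ∈ W, ε < ∑ i, max (|w i| - g i) 0) :
    ∀ n : ℕ, lam * M * n ≤ C → 0 ≤ M → ∃ w : ℕ → Fin m → ℝ, ∀ r < n, w r ∈ W ∧
      ε < ∑ i, max (|w r i| - lam * ∑ l ∈ Finset.range r, |w l i|) 0 := by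
  intro n
  induction n with
  | zero => intro _ _; exact ⟨fun _ _ => 0, by simp⟩
  | succ n ih =>
    intro hC hM
    obtain ⟨w, hw⟩ := ih (le_trans (by gcongr; simp) hC) hM
    obtain ⟨v, hv, hvε⟩ := h (fun i => lam * ∑ l ∈ Finset.range n, |w l i|)
      (fun i => by positivity) (by
        rw [← Finset.mul_sum, Finset.sum_comm]
        have : ∑ l ∈ Finset.range n, ∑ i, |w l i| ≤ ∑ l ∈ Finset.range n, M :=
          Finset.sum_le_sum fun l hl => hW _ (hw l (Finset.mem_range.1 hl)).1
        rw [Finset.sum_const, Finset.card_range, nsmul_eq_mul] at this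
        calc lam * ∑ l ∈ Finset.range n, ∑ i, |w l i| ≤ lam * (n * M) := by gcongr
          _ = lam * M * n := by ring
          _ ≤ lam * M * (n + 1 : ℕ) := by gcongr; simp
          _ ≤ C := hC)
    refine ⟨Function.update w n v, fun r hr => ?_⟩
    have hsum : ∀ i, ∑ l ∈ Finset.range r, |Function.update w n v l i|
        = ∑ l ∈ Finset.range r, |w l i| := fun i => Finset.sum_congr rfl fun l hl => by
      have : l ≠ n := by have := Finset.mem_range.1 hl; omega
      rw [Function.update_of_ne this]
    simp only [hsum]
    rcases (Nat.lt_succ_iff.1 hr).lt_or_eq with h1 | rfl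
    · rw [Function.update_of_ne h1.ne]
      exact hw r h1
    · rw [Function.update_self]
      exact ⟨hv, hvε⟩

theorem biorth {m k : ℕ} (w : Fin k → Fin m → ℝ) (A : Fin k → Finset (Fin m)) (ε : ℝ) (hε : 0 < ε)
    (hd : ∀ a b, a ≠ b → Disjoint (A a) (A b)) (hm : ∀ a, ε / 2 ≤ ∑ i ∈ A a, |w a i|)
    (ho : ∀ a b, a ≠ b → ∑ i ∈ A a, |w b i| ≤ ε / (8 * (k + 1))) :
    ∃ φ : Fin k → Fin m → ℝ, (∀ j, ∑ a, |φ a j| ≤ 2 / ε) ∧ (∀ a, ∑ j, φ a j * w a j = 1) ∧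
      ∀ b, ∑ a ∈ Finset.univ.erase b, |∑ j, φ a j * w b j| ≤ 1 / 4 := by
  classical
  set μ : Fin k → ℝ := fun a => ∑ i ∈ A a, |w a i| with hμ
  have hμp : ∀ a, 0 < μ a := fun a => lt_of_lt_of_le (by linarith) (hm a)
  have hμi : ∀ a, (μ a)⁻¹ ≤ 2 / ε := fun a => by
    rw [show 2 / ε = (ε / 2)⁻¹ by rw [inv_div]]
    exact inv_anti₀ (by linarith) (hm a)
  let φ : Fin k → Fin m → ℝ := fun a j => if j ∈ A a then SignType.sign (w a j) * (μ a)⁻¹ else 0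
  have hφ : ∀ a j, |φ a j| ≤ if j ∈ A a then 2 / ε else 0 := by
    intro a j
    simp only [φ]
    split_ifs with hj
    · rw [abs_mul, abs_of_pos (inv_pos.2 (hμp a))]
      have h1 : |((SignType.sign (w a j) : SignType) : ℝ)| ≤ 1 := by
        rcases SignType.sign (w a j) with _ | _ | _ <;> simp
      have := hμi a
      have h3 := inv_pos.2 (hμp a)
      nlinarith
    · simp
  have hpe : 0 < 2 / ε := by positivity
  refine ⟨φ, fun j => ?_, fun a => ?_, fun b => ?_⟩
  · refine le_trans (Finset.sum_le_sum fun a _ => hφ a j) ?_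
    by_cases h : ∃ a, j ∈ A a
    · obtain ⟨a, ha⟩ := h
      rw [Finset.sum_eq_single a]
      · rw [if_pos ha]
      · intro b _ hb
        rw [if_neg]
        exact fun hj => Finset.disjoint_left.1 (hd b a hb) hj ha
      · simp
    · push Not at h
      simp [h, hpe.le]
  · have : ∀ j, φ a j * w a j = if j ∈ A a then |w a j| * (μ a)⁻¹ else 0 := by
      intro j
      simp only [φ]
      split_ifs
      · rw [← sign_mul_self (w a j)]; ring
      · simp
    simp only [this]
    rw [← Finset.sum_filter, Finset.filter_mem_eq_inter, Finset.univ_inter, ← Finset.sum_mul]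
    exact mul_inv_cancel₀ (hμp a).ne'
  · have h1 : ∀ a ∈ Finset.univ.erase b, |∑ j, φ a j * w b j| ≤ 1 / (4 * (k + 1)) := by
      intro a ha
      have hab := Finset.ne_of_mem_erase ha
      refine le_trans (Finset.abs_sum_le_sum_abs _ _) ?_
      calc ∑ j, |φ a j * w b j| ≤ ∑ j, if j ∈ A a then 2 / ε * |w b j| else 0 := by
            refine Finset.sum_le_sum fun j _ => ?_
            rw [abs_mul]
            have := hφ a j
            split_ifs with hj
            · rw [if_pos hj] at this
              gcongr
            · rw [if_neg hj] at this
              have h0 : |φ a j| = 0 := le_antisymm this (abs_nonneg _)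
              rw [h0, zero_mul]
        _ = 2 / ε * ∑ j ∈ A a, |w b j| := by
            rw [← Finset.sum_filter, Finset.filter_mem_eq_inter, Finset.univ_inter, Finset.mul_sum]
        _ ≤ 2 / ε * (ε / (8 * (k + 1))) := by
            gcongr
            exact ho a b hab
        _ = 1 / (4 * (k + 1)) := by field_simp; norm_num
    refine le_trans (Finset.sum_le_sum h1) ?_
    rw [Finset.sum_const, nsmul_eq_mul]
    have hc : ((Finset.univ.erase b).card : ℝ) ≤ k := by
      have := Finset.card_le_univ (Finset.univ.erase b)
      rw [Fintype.card_fin] at this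
      exact_mod_cast this
    calc ((Finset.univ.erase b).card : ℝ) * (1 / (4 * (k + 1))) ≤ (k + 1) * (1 / (4 * (k + 1))) := by
          gcongr; linarith
      _ = 1 / 4 := by field_simp

theorem sum_biUnion_le' {I J : Type} [DecidableEq I] [DecidableEq J] (s : Finset I)
    (A : I → Finset J) (f : J → ℝ) (hf : ∀ j, 0 ≤ f j) :
    ∑ j ∈ s.biUnion A, f j ≤ ∑ i ∈ s, ∑ j ∈ A i, f j := by
  induction s using Finset.induction_on with
  | empty => simp
  | insert a s ha ih =>
    rw [Finset.biUnion_insert, Finset.sum_insert ha]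
    have h1 := Finset.sum_union_inter (s₁ := A a) (s₂ := s.biUnion A) (f := f)
    have h2 : 0 ≤ ∑ j ∈ A a ∩ s.biUnion A, f j := Finset.sum_nonneg fun j _ => hf j
    linarith

theorem core_pre {m : ℕ} (w : ℕ → Fin m → ℝ) (ε M lam θ : ℝ) (n k D : ℕ) (hε : 0 < ε) (hM : 0 < M)
    (hl : 0 < lam) (hθ : 0 < θ) (hlθ : M / lam ≤ θ) (hln : n * (M / lam) ≤ ε / 2)
    (hD : M / θ < D + 1) (hn : k * (D + 1) ≤ n)
    (hwM : ∀ r < n, ∑ i, |w r i| ≤ M)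
    (hw : ∀ r < n, ε < ∑ i, max (|w r i| - lam * ∑ l ∈ Finset.range r, |w l i|) 0) :
    ∃ (f : Fin k → ℕ) (A : Fin k → Finset (Fin m)), (∀ a, f a < n) ∧
      (∀ a b, a ≠ b → Disjoint (A a) (A b)) ∧ (∀ a, ε / 2 ≤ ∑ i ∈ A a, |w (f a) i|) ∧
      (∀ a b, a ≠ b → ∑ i ∈ A a, |w (f b) i| ≤ θ) := by
  classical
  let A : ℕ → Finset (Fin m) := fun r =>
    Finset.univ.filter fun i => lam * ∑ l ∈ Finset.range r, |w l i| < |w r i|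
  have hA1 : ∀ r < n, ε < ∑ i ∈ A r, |w r i| := by
    intro r hr
    refine lt_of_lt_of_le (hw r hr) ?_
    rw [Finset.sum_filter]
    refine Finset.sum_le_sum fun i _ => ?_
    have h0 : 0 ≤ lam * ∑ l ∈ Finset.range r, |w l i| := by positivity
    split_ifs with h
    · exact max_le (by linarith) (abs_nonneg _)
    · exact max_le (by linarith) le_rfl
  have hsubM : ∀ r < n, ∀ B : Finset (Fin m), ∑ i ∈ B, |w r i| ≤ M := fun r hr B =>
    le_trans (Finset.sum_le_sum_of_subset_of_nonneg (Finset.subset_univ B)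
      (fun _ _ _ => abs_nonneg _)) (hwM r hr)
  have hA2 : ∀ r < n, ∀ l < r, ∑ i ∈ A r, |w l i| ≤ M / lam := by
    intro r hr l hlr
    rw [le_div_iff₀ hl, Finset.sum_mul]
    refine le_trans (Finset.sum_le_sum fun i hi => ?_) (hsubM r hr (A r))
    have h1 := (Finset.mem_filter.1 hi).2
    have h2 : |w l i| ≤ ∑ l ∈ Finset.range r, |w l i| :=
      Finset.single_le_sum (f := fun l => |w l i|) (fun _ _ => abs_nonneg _) (Finset.mem_range.2 hlr)
    nlinarith
  let A' : ℕ → Finset (Fin m) := fun r => A r \ (Finset.Ico (r + 1) n).biUnion A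
  have hA's : ∀ r, A' r ⊆ A r := fun r => Finset.sdiff_subset
  have hdis0 : ∀ r l, r < l → l < n → Disjoint (A' r) (A' l) := by
    intro r l hrl hln
    refine Finset.disjoint_left.2 fun i hi hi' => ?_
    refine (Finset.mem_sdiff.1 hi).2 (Finset.mem_biUnion.2 ⟨l, Finset.mem_Ico.2 ⟨hrl, hln⟩, hA's l hi'⟩)
  have hdis : ∀ r l, r < n → l < n → r ≠ l → Disjoint (A' r) (A' l) := by
    intro r l hr hl' hne
    rcases lt_or_gt_of_ne hne with h | h
    · exact hdis0 r l h hl'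
    · exact (hdis0 l r h hr).symm
  have hA3 : ∀ r < n, ε / 2 ≤ ∑ i ∈ A' r, |w r i| := by
    intro r hr
    have h1 : ∑ i ∈ A r, |w r i| ≤ ∑ i ∈ A' r, |w r i| +
        ∑ i ∈ (Finset.Ico (r + 1) n).biUnion A, |w r i| := by
      have hsub : A r ⊆ A' r ∪ (Finset.Ico (r + 1) n).biUnion A := by
        intro i hi
        by_cases h : i ∈ (Finset.Ico (r + 1) n).biUnion A
        · exact Finset.mem_union_right _ h
        · exact Finset.mem_union_left _ (Finset.mem_sdiff.2 ⟨hi, h⟩)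
      refine le_trans (Finset.sum_le_sum_of_subset_of_nonneg hsub fun _ _ _ => abs_nonneg _) ?_
      rw [← Finset.sum_union_inter]
      have : 0 ≤ ∑ i ∈ A' r ∩ (Finset.Ico (r + 1) n).biUnion A, |w r i| :=
        Finset.sum_nonneg fun _ _ => abs_nonneg _
      linarith
    have h2 : ∑ i ∈ (Finset.Ico (r + 1) n).biUnion A, |w r i| ≤
        ∑ l ∈ Finset.Ico (r + 1) n, ∑ i ∈ A l, |w r i| := by
      exact sum_biUnion_le' _ _ _ fun _ => abs_nonneg _
    have h3 : ∑ l ∈ Finset.Ico (r + 1) n, ∑ i ∈ A l, |w r i| ≤ n * (M / lam) := by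
      refine le_trans (Finset.sum_le_sum (g := fun _ => M / lam) fun l hl' => ?_) ?_
      · have := Finset.mem_Ico.1 hl'
        exact hA2 l this.2 r (by omega)
      · rw [Finset.sum_const, nsmul_eq_mul]
        have : ((Finset.Ico (r + 1) n).card : ℝ) ≤ n := by
          rw [Nat.card_Ico]; exact_mod_cast Nat.sub_le _ _
        gcongr
    have := hA1 r hr
    linarith
  obtain ⟨F, hF, hFc, hFb⟩ := select_free (fun r l => θ < ∑ i ∈ A' l, |w r i|) D k (Finset.range n)
    (by
      intro r hr
      have hr := Finset.mem_range.1 hr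
      set s := (Finset.range n).filter (fun l => l < r ∧ θ < ∑ i ∈ A' l, |w r i|) with hs
      have h1 : (s.card : ℝ) * θ ≤ ∑ l ∈ s, ∑ i ∈ A' l, |w r i| := by
        rw [← nsmul_eq_mul]
        exact Finset.card_nsmul_le_sum _ _ _ fun l hl' => (Finset.mem_filter.1 hl').2.2.le
      rw [← Finset.sum_biUnion] at h1
      · have h2 := h1.trans (hsubM r hr _)
        have h3 : (s.card : ℝ) ≤ M / θ := by rwa [le_div_iff₀ hθ]
        have h4 : (s.card : ℝ) < ((D + 1 : ℕ) : ℝ) := by push_cast; linarith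
        have := Nat.cast_lt.1 h4
        omega
      · intro a ha b hb hab
        have ha' := Finset.mem_range.1 (Finset.mem_filter.1 ha).1
        have hb' := Finset.mem_range.1 (Finset.mem_filter.1 hb).1
        exact hdis a b ha' hb' hab)
    (by simpa using hn)
  let f := F.orderEmbOfFin hFc
  have hf : ∀ a, f a ∈ F := fun a => F.orderEmbOfFin_mem hFc a
  have hfn : ∀ a, f a < n := fun a => Finset.mem_range.1 (hF (hf a))
  refine ⟨f, fun a => A' (f a), hfn, ?_, ?_, ?_⟩
  · intro a b hab
    exact hdis _ _ (hfn a) (hfn b) (fun h => hab (f.injective h))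
  · exact fun a => hA3 _ (hfn a)
  · intro a b hab
    have hne : f a ≠ f b := fun h => hab (f.injective h)
    rcases lt_or_gt_of_ne hne with h | h
    · exact not_lt.1 (hFb _ (hf b) _ (hf a) h)
    · refine le_trans ?_ ((hA2 _ (hfn a) _ h).trans hlθ)
      exact Finset.sum_le_sum_of_subset_of_nonneg (hA's _) fun _ _ _ => abs_nonneg _

theorem core (ε M : ℝ) (hε : 0 < ε) (hM : 0 < M) (k : ℕ) : ∃ C : ℝ, ∀ (m : ℕ) (W : Set (Fin m → ℝ)),
    (∀ w ∈ W, ∑ i, |w i| ≤ M) →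
    (∀ g : Fin m → ℝ, (∀ i, 0 ≤ g i) → ∑ i, g i ≤ C →
      ∃ w ∈ W, ε < ∑ i, max (|w i| - g i) 0) →
    ∃ (w : Fin k → Fin m → ℝ) (φ : Fin k → Fin m → ℝ), (∀ a, w a ∈ W) ∧
      (∀ j, ∑ a, |φ a j| ≤ 2 / ε) ∧ (∀ a, ∑ j, φ a j * w a j = 1) ∧
      ∀ b, ∑ a ∈ Finset.univ.erase b, |∑ j, φ a j * w b j| ≤ 1 / 4 := by
  set θ := ε / (8 * (k + 1)) with hθ
  have hθp : 0 < θ := by positivity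
  set D := ⌊M / θ⌋₊ with hD
  set n := k * (D + 1) with hn
  set lam := M / θ + n * M / (ε / 2) with hlam
  have hlp : 0 < lam := by positivity
  refine ⟨lam * M * n, fun m W hW h => ?_⟩
  obtain ⟨w, hw⟩ := greedy W ε M _ lam hlp.le hW h n le_rfl hM.le
  obtain ⟨f, A, hf, hd, hm, ho⟩ := core_pre w ε M lam θ n k D hε hM hlp hθp
    (by
      rw [div_le_iff₀ hlp, hlam, mul_add]
      have : θ * (M / θ) = M := by field_simp
      have h2 : 0 ≤ θ * (n * M / (ε / 2)) := by positivity
      linarith)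
    (by
      rw [← mul_div_assoc, div_le_iff₀ hlp, hlam, mul_add]
      have : ε / 2 * (n * M / (ε / 2)) = n * M := by field_simp
      have h2 : 0 ≤ ε / 2 * (M / θ) := by positivity
      linarith)
    (Nat.lt_floor_add_one _) le_rfl (fun r hr => hW _ (hw r hr).1) (fun r hr => (hw r hr).2)
  obtain ⟨φ, h1, h2, h3⟩ := biorth (fun a => w (f a)) A ε hε hd hm ho
  exact ⟨fun a => w (f a), φ, fun a => (hw _ (hf a)).1, h1, h2, h3⟩


/-- Order-boundedness fails uniformly at level `ε`. -/
def Fails (T : Xsp →L[ℝ] Xsp) (ε : ℝ) : Prop :=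
  ∀ C : ℝ, ∃ m : ℕ, ∀ g : Fin m → ℝ, (∀ i, 0 ≤ g i) → ∑ i, g i ≤ C →
    ∃ x : Xsp, ‖x‖ ≤ 1 ∧ ε < ∑ i, max (|coX m (T x) i| - g i) 0

theorem fails_of_not_OB (T : Xsp →L[ℝ] Xsp) (h : ¬ OB T) : ∃ ε : ℝ, 0 < ε ∧ Fails T ε := by
  unfold OB at h
  push Not at h
  exact h

theorem continuous_excess (T : Xsp →L[ℝ] Xsp) (m : ℕ) (g : Fin m → ℝ) :
    Continuous fun x : Xsp => ∑ i, max (|coX m (T x) i| - g i) 0 := by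
  refine continuous_finsetSum _ fun i _ => ?_
  have h1 : Continuous fun x : Xsp => coX m (T x) := (coX m).continuous.comp T.continuous
  have h2 : Continuous fun y : ell1 m => y i := (PiLp.proj (𝕜 := ℝ) 1 (fun _ : Fin m => ℝ) i).continuous
  exact (((h2.comp h1).abs).sub continuous_const).max continuous_const

theorem coX_T_le (T : Xsp →L[ℝ] Xsp) (m : ℕ) (x : Xsp) (hx : ‖x‖ ≤ 1) : ‖coX m (T x)‖ ≤ ‖T‖ := by
  refine (coX_norm_le _ _).trans ((T.le_opNorm x).trans ?_)
  have := norm_nonneg T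
  nlinarith

theorem fail_tail (T : Xsp →L[ℝ] Xsp) (ε : ℝ) (hε : 0 < ε) (h : Fails T ε) (N : ℕ) (C : ℝ) :
    ∃ m, N ≤ m ∧ ∀ g : Fin m → ℝ, (∀ i, 0 ≤ g i) → ∑ i, g i ≤ C →
    ∃ x : Xsp, ‖x‖ ≤ 1 ∧ (∀ n < N, coX n x = 0) ∧ (∃ N', ∀ n, N' ≤ n → coX n x = 0) ∧
      ε < ∑ i, max (|coX m (T x) i| - g i) 0 := by
  set B : ℝ := ∑ n ∈ Finset.range N, ∑ _j : Fin n, ‖T‖ with hB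
  have hB0 : 0 ≤ B := by positivity
  obtain ⟨m, hm⟩ := h (|C| + B + N * ‖T‖)
  have hNT : 0 ≤ N * ‖T‖ := by positivity
  refine ⟨m, ?_, fun g hg hgC => ?_⟩
  · by_contra hlt
    push Not at hlt
    obtain ⟨x, hx, hxε⟩ := hm (fun _ => ‖T‖) (fun _ => norm_nonneg T) (by
      rw [Finset.sum_const, Finset.card_univ, Fintype.card_fin, nsmul_eq_mul]
      have : (m : ℝ) * ‖T‖ ≤ N * ‖T‖ := by gcongr
      have := abs_nonneg C
      linarith)
    have : ∑ i, max (|coX m (T x) i| - ‖T‖) 0 ≤ 0 := by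
      refine Finset.sum_nonpos fun i _ => max_le ?_ le_rfl
      have := (ell1_coord_le (coX m (T x)) i).trans (coX_T_le T m x hx)
      linarith
    linarith
  · let H : Fin m → ℝ := fun i => ∑ n ∈ Finset.range N, ∑ j : Fin n, |coX m (T (eX n j)) i|
    have hH0 : ∀ i, 0 ≤ H i := fun i =>
      Finset.sum_nonneg fun n _ => Finset.sum_nonneg fun j _ => abs_nonneg _
    have hHB : ∑ i, H i ≤ B := by
      simp only [H]
      rw [Finset.sum_comm]
      refine Finset.sum_le_sum fun n _ => ?_
      rw [Finset.sum_comm]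
      refine Finset.sum_le_sum fun j _ => ?_
      rw [← ell1_norm]
      exact coX_T_le T m _ (eX_norm_le n j)
    obtain ⟨x, hx, hxε⟩ := hm (fun i => g i + H i) (fun i => add_nonneg (hg i) (hH0 i)) (by
      rw [Finset.sum_add_distrib]
      have := le_abs_self C
      linarith)
    set x2 := x - trunc (Set.Iio N) x with hx2
    have hc1 : ∀ n < N, coX n x2 = 0 := fun n hn => by
      rw [hx2, map_sub, trunc_mem (s := Set.Iio N) hn, sub_self]
    have hc2 : ∀ n, N ≤ n → coX n x2 = coX n x := fun n hn => by
      rw [hx2, map_sub, trunc_not_mem (s := Set.Iio N) (by simpa using hn), sub_zero]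
    have hx2n : ‖x2‖ ≤ 1 := by
      refine X_norm_le zero_le_one fun n => ?_
      rcases lt_or_ge n N with h1 | h1
      · rw [hc1 n h1]; simp
      · rw [hc2 n h1]; exact (coX_norm_le n x).trans hx
    have hkey : ∀ i, |coX m (T x) i| ≤ H i + |coX m (T x2) i| := by
      intro i
      have e1 : coX m (T x) i = coX m (T (trunc (Set.Iio N) x)) i + coX m (T x2) i := by
        rw [← PiLp.add_apply, ← map_add, ← map_add, hx2, add_sub_cancel]
      have e2 : coX m (T (trunc (Set.Iio N) x)) i =
          ∑ n ∈ Finset.range N, ∑ j : Fin n, coX n x j * coX m (T (eX n j)) i := by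
        have e3 : ∀ y : ell1 m, y i = PiLp.proj (𝕜 := ℝ) 1 (fun _ : Fin m => ℝ) i y := fun _ => rfl
        rw [trunc_Iio]
        simp only [e3, map_sum, map_smul, smul_eq_mul]
      have e4 : |coX m (T (trunc (Set.Iio N) x)) i| ≤ H i := by
        rw [e2]
        refine (Finset.abs_sum_le_sum_abs _ _).trans (Finset.sum_le_sum fun n _ => ?_)
        refine (Finset.abs_sum_le_sum_abs _ _).trans (Finset.sum_le_sum fun j _ => ?_)
        rw [abs_mul]
        have h1 := (ell1_coord_le (coX n x) j).trans ((coX_norm_le n x).trans hx)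
        exact mul_le_of_le_one_left (abs_nonneg _) h1
      rw [e1]
      exact (abs_add_le _ _).trans (by linarith)
    have hlt : ε < ∑ i, max (|coX m (T x2) i| - g i) 0 := by
      refine lt_of_lt_of_le hxε (Finset.sum_le_sum fun i _ => max_le_max ?_ le_rfl)
      have := hkey i
      linarith
    have hev := ((continuous_excess T m g).tendsto x2).comp (trunc_tendsto x2)
    obtain ⟨N', hN'⟩ := (hev.eventually (lt_mem_nhds hlt)).exists
    refine ⟨trunc (Set.Iio N') x2, (trunc_norm_le _ _).trans hx2n, fun n hn => ?_, ⟨N', fun n hn => ?_⟩, hN'⟩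
    · by_cases h1 : n < N'
      · rw [trunc_mem (s := Set.Iio N') h1, hc1 n hn]
      · rw [trunc_not_mem (s := Set.Iio N') h1]
    · rw [trunc_not_mem (s := Set.Iio N') (by simpa using hn)]

theorem small_tail_fun (f : Xsp →L[ℝ] ℝ) (δ : ℝ) (hδ : 0 < δ) :
    ∃ N, ∀ z : Xsp, (∀ n < N, coX n z = 0) → |f z| ≤ δ * ‖z‖ := by
  by_cases hf : ‖f‖ = 0
  · refine ⟨0, fun z _ => ?_⟩
    have := f.le_opNorm z
    rw [hf, zero_mul, Real.norm_eq_abs] at this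
    exact this.trans (by positivity)
  obtain ⟨x, hx, hfx⟩ : ∃ x : Xsp, ‖x‖ ≤ 1 ∧ ‖f‖ - δ < |f x| := by
    by_contra hcon
    push Not at hcon
    have h0 : 0 ≤ ‖f‖ - δ := by
      have := hcon 0 (by simp)
      simpa using this
    have := ContinuousLinearMap.opNorm_le_of_unit_norm (f := f) h0 (fun x hx => hcon x hx.le)
    linarith
  have hev := ((f.continuous.abs).tendsto x).comp (trunc_tendsto x)
  obtain ⟨N, hN⟩ := (hev.eventually (lt_mem_nhds hfx)).exists
  simp only [Function.comp] at hN
  set y := trunc (Set.Iio N) x with hy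
  refine ⟨N, fun z hz => ?_⟩
  have hn : ∀ s : ℝ, |s| = 1 → ‖‖z‖ • y + s • z‖ ≤ ‖z‖ := by
    intro s hs
    refine X_norm_le (norm_nonneg _) fun n => ?_
    rw [map_add, map_smul, map_smul]
    by_cases h1 : n < N
    · rw [hz n h1, smul_zero, add_zero, norm_smul, norm_norm]
      have : ‖coX n y‖ ≤ 1 := (coX_norm_le n y).trans ((trunc_norm_le _ _).trans hx)
      exact mul_le_of_le_one_right (norm_nonneg _) this
    · rw [hy, trunc_not_mem (s := Set.Iio N) h1, smul_zero, zero_add, norm_smul, Real.norm_eq_abs, hs, one_mul]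
      exact coX_norm_le n z
  have hb : ∀ s : ℝ, |s| = 1 → |‖z‖ * f y + s * f z| ≤ ‖f‖ * ‖z‖ := by
    intro s hs
    have h1 := f.le_opNorm (‖z‖ • y + s • z)
    rw [map_add, map_smul, map_smul, Real.norm_eq_abs, smul_eq_mul, smul_eq_mul] at h1
    exact h1.trans (by gcongr; exact hn s hs)
  have b1 := hb 1 (by simp)
  have b2 := hb (-1) (by simp)
  have hz0 := norm_nonneg z
  have h3 : ‖z‖ * |f y| + |f z| ≤ ‖f‖ * ‖z‖ := by
    rw [abs_le] at b1 b2
    rcases abs_cases (f y) with ⟨h, _⟩ | ⟨h, _⟩ <;> rcases abs_cases (f z) with ⟨h', _⟩ | ⟨h', _⟩ <;>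
      rw [h, h'] <;> linarith
  nlinarith

theorem small_tail (m : ℕ) (L : Xsp →L[ℝ] ell1 m) (δ : ℝ) (hδ : 0 < δ) :
    ∃ N, ∀ z : Xsp, (∀ n < N, coX n z = 0) → ‖L z‖ ≤ δ * ‖z‖ := by
  have h : ∀ i : Fin m, ∃ N, ∀ z : Xsp, (∀ n < N, coX n z = 0) → |L z i| ≤ δ / (m + 1) * ‖z‖ :=
    fun i => small_tail_fun ((PiLp.proj (𝕜 := ℝ) 1 (fun _ : Fin m => ℝ) i).comp L) _ (by positivity)
  choose N hN using h
  refine ⟨Finset.univ.sup N, fun z hz => ?_⟩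
  rw [ell1_norm]
  calc ∑ i, |L z i| ≤ ∑ _i : Fin m, δ / (m + 1) * ‖z‖ := Finset.sum_le_sum fun i _ =>
        hN i z fun n hn => hz n (lt_of_lt_of_le hn (Finset.le_sup (Finset.mem_univ i)))
    _ = m * (δ / (m + 1) * ‖z‖) := by simp
    _ ≤ (m + 1) * (δ / (m + 1) * ‖z‖) := by gcongr; linarith
    _ = δ * ‖z‖ := by field_simp

theorem exists_mat {m k : ℕ} (φ : Fin k → Fin m → ℝ) (K : ℝ) (hφ : ∀ j, ∑ a, |φ a j| ≤ K) :
    ∃ P : ell1 m →ₗ[ℝ] ell1 k, (∀ y i, P y i = ∑ q, φ i q * y q) ∧ ∀ y, ‖P y‖ ≤ K * ‖y‖ := by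
  let P : ell1 m →ₗ[ℝ] ell1 k :=
    { toFun := fun y => WithLp.toLp 1 fun i => ∑ q, φ i q * y q
      map_add' := fun x y => by
        ext i
        simp [mul_add, Finset.sum_add_distrib]
      map_smul' := fun c x => by
        ext i
        simp [Finset.mul_sum, mul_left_comm] }
  have hP : ∀ y i, P y i = ∑ q, φ i q * y q := fun y i => rfl
  refine ⟨P, hP, fun y => ?_⟩
  rw [ell1_norm, ell1_norm, Finset.mul_sum]
  calc ∑ i, |P y i| ≤ ∑ i, ∑ q, |φ i q| * |y q| := by
        refine Finset.sum_le_sum fun i _ => ?_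
        rw [hP]
        refine (Finset.abs_sum_le_sum_abs _ _).trans (le_of_eq ?_)
        simp only [abs_mul]
    _ = ∑ q, (∑ i, |φ i q|) * |y q| := by
        rw [Finset.sum_comm]
        simp only [Finset.sum_mul]
    _ ≤ ∑ q, K * |y q| := Finset.sum_le_sum fun q _ => by gcongr; exact hφ q

theorem mat_close {m k : ℕ} (w : Fin k → ell1 m) (φ : Fin k → Fin m → ℝ)
    (P : ell1 m →ₗ[ℝ] ell1 k) (hP : ∀ y i, P y i = ∑ q, φ i q * y q)
    (h1 : ∀ a, ∑ j, φ a j * w a j = 1)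
    (h2 : ∀ b, ∑ a ∈ Finset.univ.erase b, |∑ j, φ a j * w b j| ≤ 1 / 4) (x : ell1 k) :
    ‖P (∑ j, x j • w j) - x‖ ≤ 1 / 4 * ‖x‖ := by
  have hb : ∀ b, ‖P (w b) - e1 k b‖ ≤ 1 / 4 := by
    intro b
    rw [ell1_norm, ← Finset.add_sum_erase _ _ (Finset.mem_univ b)]
    have e0 : |(P (w b) - e1 k b) b| = 0 := by
      rw [PiLp.sub_apply, hP, h1]
      simp [e1]
    rw [e0, zero_add]
    refine le_trans (le_of_eq (Finset.sum_congr rfl fun a ha => ?_)) (h2 b)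
    rw [PiLp.sub_apply, hP]
    simp [e1, Finset.ne_of_mem_erase ha]
  have : P (∑ j, x j • w j) - x = ∑ j, x j • (P (w j) - e1 k j) := by
    simp only [smul_sub, Finset.sum_sub_distrib, map_sum, map_smul]
    rw [← ell1_eq_sum]
  rw [this, ell1_norm x, Finset.mul_sum]
  refine norm_sum_le_of_le _ fun j _ => ?_
  rw [norm_smul, Real.norm_eq_abs, mul_comm]
  gcongr
  exact hb j

theorem step (T : Xsp →L[ℝ] Xsp) (ε : ℝ) (hε : 0 < ε) (h : Fails T ε) (δ : ℝ) (hδ : 0 < δ)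
    (k N : ℕ) : ∃ (m N' : ℕ) (v : Fin k → Xsp) (P : ell1 m →ₗ[ℝ] ell1 k),
      N ≤ m ∧ m < N' ∧ (∀ j, ‖v j‖ ≤ 1) ∧ (∀ j, ∀ n < N, coX n (v j) = 0) ∧
      (∀ j n, N' ≤ n → coX n (v j) = 0) ∧ (∀ y, ‖P y‖ ≤ 2 / ε * ‖y‖) ∧
      (∀ x : ell1 k, ‖P (∑ j, x j • coX m (T (v j))) - x‖ ≤ 1 / 4 * ‖x‖) ∧
      (∀ z : Xsp, (∀ n < N', coX n z = 0) → ‖coX m (T z)‖ ≤ δ * ‖z‖) ∧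
      (∀ m', N' ≤ m' → ∑ j, ‖coX m' (T (v j))‖ ≤ δ * (1 / 2) ^ (k + 1)) := by
  obtain ⟨C, hC⟩ := core ε (‖T‖ + 1) hε (by positivity) k
  obtain ⟨m, hNm, hm⟩ := fail_tail T ε hε h N C
  obtain ⟨w, φ, hw, h1, h2, h3⟩ := hC m {w | ∃ x : Xsp, ‖x‖ ≤ 1 ∧ (∀ n < N, coX n x = 0) ∧
      (∃ N', ∀ n, N' ≤ n → coX n x = 0) ∧ ∀ i, w i = coX m (T x) i}
    (by
      rintro w ⟨x, hx, -, -, hw⟩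
      simp only [hw]
      rw [← ell1_norm]
      have := coX_T_le T m x hx
      linarith)
    (by
      intro g hg hgC
      obtain ⟨x, hx, ha, hb, hc⟩ := hm g hg hgC
      exact ⟨fun i => coX m (T x) i, ⟨x, hx, ha, hb, fun _ => rfl⟩, hc⟩)
  choose v hv hva hvb hvw using hw
  choose Nv hNv using hvb
  obtain ⟨P, hP, hPn⟩ := exists_mat φ _ h1
  obtain ⟨N1, hN1⟩ := small_tail m ((coX m).comp T) δ hδ
  have hlim : Tendsto (fun m' => ∑ j, ‖coX m' (T (v j))‖) atTop (𝓝 0) := by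
    have := tendsto_finsetSum (Finset.univ : Finset (Fin k)) fun j _ => coX_tendsto (T (v j))
    simpa using this
  have hpos : 0 < δ * (1 / 2) ^ (k + 1) := by positivity
  obtain ⟨N2, hN2⟩ := eventually_atTop.1 (hlim.eventually (ge_mem_nhds hpos))
  refine ⟨m, (m + 1) + Finset.univ.sup Nv + N1 + N2, v, P, hNm, by omega, hv, hva, ?_, hPn, ?_, ?_, ?_⟩
  · intro j n hn
    have : Nv j ≤ Finset.univ.sup Nv := Finset.le_sup (Finset.mem_univ j)
    exact hNv j n (by omega)
  · refine mat_close (fun j => coX m (T (v j))) φ P hP (fun a => ?_) (fun b => ?_)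
    · simpa only [hvw] using h2 a
    · simpa only [hvw] using h3 b
  · intro z hz
    exact hN1 z fun n hn => hz n (by omega)
  · intro m' hm'
    exact hN2 m' (by omega)


/-- The data of a gliding-hump sequence for `T`. -/
structure Hump (T : Xsp →L[ℝ] Xsp) (K δ : ℝ) where
  Ns : ℕ → ℕ
  ms : ℕ → ℕ
  v : ∀ k, Fin k → Xsp
  P : ∀ k, ell1 (ms k) →ₗ[ℝ] ell1 k
  Ns0 : Ns 0 = 0
  hNm : ∀ k, Ns k ≤ ms k
  hmN : ∀ k, ms k < Ns (k + 1)
  hv : ∀ k j, ‖v k j‖ ≤ 1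
  hv1 : ∀ k j, ∀ n < Ns k, coX n (v k j) = 0
  hv2 : ∀ k j n, Ns (k + 1) ≤ n → coX n (v k j) = 0
  hP : ∀ k y, ‖P k y‖ ≤ K * ‖y‖
  hPx : ∀ k (x : ell1 k), ‖P k (∑ j, x j • coX (ms k) (T (v k j))) - x‖ ≤ 1 / 4 * ‖x‖
  ha : ∀ k (z : Xsp), (∀ n < Ns (k + 1), coX n z = 0) → ‖coX (ms k) (T z)‖ ≤ δ * ‖z‖
  hb : ∀ k m', Ns (k + 1) ≤ m' → ∑ j, ‖coX m' (T (v k j))‖ ≤ δ * (1 / 2) ^ (k + 1)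

theorem exists_hump (T : Xsp →L[ℝ] Xsp) (ε : ℝ) (hε : 0 < ε) (h : Fails T ε) (δ : ℝ) (hδ : 0 < δ) :
    Nonempty (Hump T (2 / ε) δ) := by
  choose m N' v P h1 h2 h3 h4 h5 h6 h7 h8 h9 using step T ε hε h δ hδ
  let Ns : ℕ → ℕ := fun k => Nat.rec 0 (fun k N => N' k N) k
  have hs : ∀ k, Ns (k + 1) = N' k (Ns k) := fun k => rfl
  exact ⟨{
    Ns := Ns
    ms := fun k => m k (Ns k)
    v := fun k => v k (Ns k)
    P := fun k => P k (Ns k)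
    Ns0 := rfl
    hNm := fun k => h1 k (Ns k)
    hmN := fun k => h2 k (Ns k)
    hv := fun k => h3 k (Ns k)
    hv1 := fun k => h4 k (Ns k)
    hv2 := fun k => h5 k (Ns k)
    hP := fun k => h6 k (Ns k)
    hPx := fun k => h7 k (Ns k)
    ha := fun k => h8 k (Ns k)
    hb := fun k => h9 k (Ns k) }⟩

namespace Hump

variable {T : Xsp →L[ℝ] Xsp} {K δ : ℝ} (H : Hump T K δ)

theorem Ns_lt (k : ℕ) : H.Ns k < H.Ns (k + 1) := lt_of_le_of_lt (H.hNm k) (H.hmN k)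

theorem Ns_strictMono : StrictMono H.Ns := strictMono_nat_of_lt_succ H.Ns_lt

theorem exists_kk (n : ℕ) : ∃ k, H.Ns k ≤ n ∧ n < H.Ns (k + 1) := by
  classical
  have hex : ∃ k, n < H.Ns (k + 1) := ⟨n, lt_of_lt_of_le (Nat.lt_succ_self n) (H.Ns_strictMono.le_apply)⟩
  refine ⟨Nat.find hex, ?_, Nat.find_spec hex⟩
  rcases hz : Nat.find hex with _ | k
  · rw [H.Ns0]; exact Nat.zero_le _
  · exact not_lt.1 (Nat.find_min hex (m := k) (by omega))

/-- The block containing `n`. -/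
def kk (n : ℕ) : ℕ := (H.exists_kk n).choose

theorem kk_le (n : ℕ) : H.Ns (H.kk n) ≤ n := (H.exists_kk n).choose_spec.1

theorem lt_kk (n : ℕ) : n < H.Ns (H.kk n + 1) := (H.exists_kk n).choose_spec.2

theorem kk_tendsto : Tendsto H.kk atTop atTop := by
  refine tendsto_atTop.2 fun b => ?_
  filter_upwards [eventually_ge_atTop (H.Ns b)] with n hn
  have := H.Ns_strictMono.lt_iff_lt.1 (lt_of_le_of_lt hn (H.lt_kk n))
  omega

theorem ms_tendsto : Tendsto H.ms atTop atTop :=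
  tendsto_atTop_mono (fun k => (H.Ns_strictMono.le_apply).trans (H.hNm k)) tendsto_id

theorem v_zero {k n : ℕ} (h : H.kk n ≠ k) (j : Fin k) : coX n (H.v k j) = 0 := by
  rcases lt_or_gt_of_ne h with h | h
  · refine H.hv1 k j n (lt_of_lt_of_le (H.lt_kk n) ?_)
    exact H.Ns_strictMono.monotone h
  · refine H.hv2 k j n (le_trans ?_ (H.kk_le n))
    exact H.Ns_strictMono.monotone h

theorem exists_R : ∃ R : Xsp →L[ℝ] Xsp, (∀ n x, coX n (R x) =
    ∑ j, coX (H.kk n) x j • coX n (H.v (H.kk n) j)) ∧ ∀ x, ‖R x‖ ≤ ‖x‖ := by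
  let L : ∀ n, Xsp →ₗ[ℝ] ell1 n := fun n =>
    { toFun := fun x => ∑ j, coX (H.kk n) x j • coX n (H.v (H.kk n) j)
      map_add' := fun x y => by
        rw [← Finset.sum_add_distrib]
        refine Finset.sum_congr rfl fun j _ => ?_
        rw [map_add, PiLp.add_apply, add_smul]
      map_smul' := fun c x => by
        rw [Finset.smul_sum]
        refine Finset.sum_congr rfl fun j _ => ?_
        rw [map_smul, PiLp.smul_apply, smul_smul]
        rfl }
  have hL : ∀ n x, L n x = ∑ j, coX (H.kk n) x j • coX n (H.v (H.kk n) j) := fun n x => rfl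
  have hb : ∀ n x, ‖L n x‖ ≤ ‖coX (H.kk n) x‖ := by
    intro n x
    rw [hL, ell1_norm (coX (H.kk n) x)]
    refine norm_sum_le_of_le _ fun j _ => ?_
    rw [norm_smul, Real.norm_eq_abs]
    exact mul_le_of_le_one_right (abs_nonneg _) ((coX_norm_le _ _).trans (H.hv _ j))
  obtain ⟨R, hR⟩ := exists_op L 1 (fun n x => by
    rw [one_mul]; exact (hb n x).trans (coX_norm_le _ _)) (fun x =>
    squeeze_zero (fun n => norm_nonneg _) (fun n => hb n x) ((coX_tendsto x).comp H.kk_tendsto))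
  refine ⟨R, fun n x => (hR n x).trans (hL n x), fun x => ?_⟩
  refine X_norm_le (norm_nonneg _) fun n => ?_
  rw [hR]
  exact (hb n x).trans (coX_norm_le _ _)

theorem exists_S : ∃ S : Xsp →L[ℝ] Xsp, ∀ k y, coX k (S y) = H.P k (coX (H.ms k) y) := by
  have hb : ∀ k (y : Xsp), ‖H.P k (coX (H.ms k) y)‖ ≤ K * ‖coX (H.ms k) y‖ := fun k y => H.hP k _
  have hK : ∀ (y : Xsp) k, ‖H.P k (coX (H.ms k) y)‖ ≤ |K| * ‖coX (H.ms k) y‖ := fun y k =>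
    (hb k y).trans (by gcongr; exact le_abs_self K)
  obtain ⟨S, hS⟩ := exists_op
    (fun k => (H.P k).comp ((coX (H.ms k) : Xsp →L[ℝ] ell1 (H.ms k)) : Xsp →ₗ[ℝ] ell1 (H.ms k))) |K|
    (fun k y => (hK y k).trans (by gcongr; exact coX_norm_le _ _))
    (fun y => squeeze_zero (fun n => norm_nonneg _) (fun n => hK y n) (by
      simpa using ((coX_tendsto y).comp H.ms_tendsto).const_mul |K|))
  exact ⟨S, fun k y => hS k y⟩

theorem R_eX (R : Xsp →L[ℝ] Xsp) (hR : ∀ n x, coX n (R x) =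
    ∑ j, coX (H.kk n) x j • coX n (H.v (H.kk n) j)) (l : ℕ) (j : Fin l) : R (eX l j) = H.v l j := by
  refine X_ext fun n => ?_
  rw [hR]
  by_cases h : H.kk n = l
  · subst h
    rw [eX_self, Finset.sum_eq_single j]
    · simp [e1]
    · intro b _ hb
      simp [e1, hb]
    · simp
  · rw [H.v_zero h, eX_ne h]
    simp

theorem est (hK : 0 ≤ K) (hδ : 0 ≤ δ) (R : Xsp →L[ℝ] Xsp) (hR : ∀ n x, coX n (R x) =
    ∑ j, coX (H.kk n) x j • coX n (H.v (H.kk n) j)) (hRn : ∀ x, ‖R x‖ ≤ ‖x‖) (k : ℕ) (x : Xsp) :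
    ‖H.P k (coX (H.ms k) (T (R x))) - coX k x‖ ≤ (1 / 4 + 2 * (K * δ)) * ‖x‖ := by
  set x1 := trunc (Set.Iio k) x with hx1
  set x2 := trunc {k} x with hx2
  set x3 := trunc (Set.Ioi k) x with hx3
  have hx : x = x1 + x2 + x3 := by
    refine X_ext fun n => ?_
    rw [map_add, map_add]
    rcases lt_trichotomy n k with h | h | h
    · rw [hx1, hx2, hx3, trunc_mem (s := Set.Iio k) h, trunc_not_mem (s := {k}) (by simp; omega),
        trunc_not_mem (s := Set.Ioi k) (by simp; omega), add_zero, add_zero]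
    · rw [hx1, hx2, hx3, trunc_not_mem (s := Set.Iio k) (by simp; omega), trunc_mem (s := {k}) h,
        trunc_not_mem (s := Set.Ioi k) (by simp; omega), zero_add, add_zero]
    · rw [hx1, hx2, hx3, trunc_not_mem (s := Set.Iio k) (by simp; omega),
        trunc_not_mem (s := {k}) (by simp; omega),
        trunc_mem (s := Set.Ioi k) h, zero_add, zero_add]
  have e1 : ‖coX (H.ms k) (T (R x1))‖ ≤ δ * ‖x‖ := by
    rw [hx1, trunc_Iio]
    simp only [map_sum, map_smul, H.R_eX R hR]
    have hterm : ∀ n ∈ Finset.range k, ‖∑ j, coX n x j • coX (H.ms k) (T (H.v n j))‖ ≤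
        ‖x‖ * (δ * (1 / 2) ^ (n + 1)) := by
      intro n hn
      have hn := Finset.mem_range.1 hn
      have h1 := H.hb n (H.ms k) ((H.Ns_strictMono.monotone hn).trans (H.hNm k))
      refine le_trans ?_ (mul_le_mul_of_nonneg_left h1 (norm_nonneg x))
      rw [Finset.mul_sum]
      refine norm_sum_le_of_le _ fun j _ => ?_
      rw [norm_smul, Real.norm_eq_abs]
      gcongr
      exact (ell1_coord_le _ _).trans (coX_norm_le _ _)
    refine (norm_sum_le_of_le _ hterm).trans ?_
    have hgeo : ∑ n ∈ Finset.range k, ((1 : ℝ) / 2) ^ (n + 1) ≤ 1 := by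
      have : ∀ k, ∑ n ∈ Finset.range k, ((1 : ℝ) / 2) ^ (n + 1) = 1 - (1 / 2) ^ k := by
        intro k
        induction k with
        | zero => simp
        | succ k ih => rw [Finset.sum_range_succ, ih]; ring
      rw [this]
      have : (0 : ℝ) ≤ (1 / 2) ^ k := by positivity
      linarith
    rw [← Finset.mul_sum, ← Finset.mul_sum]
    have h0 : 0 ≤ ‖x‖ * δ := mul_nonneg (norm_nonneg x) hδ
    nlinarith
  have e3 : ‖coX (H.ms k) (T (R x3))‖ ≤ δ * ‖x‖ := by
    refine (H.ha k (R x3) fun n hn => ?_).trans ?_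
    · rw [hR]
      have hk : H.kk n ≤ k := by
        have := H.Ns_strictMono.lt_iff_lt.1 (lt_of_le_of_lt (H.kk_le n) hn)
        omega
      have h0 : coX (H.kk n) x3 = 0 := by
        rw [hx3, trunc_not_mem (s := Set.Ioi k) (by simpa using hk)]
      rw [h0]
      simp
    · gcongr
      exact (hRn _).trans (trunc_norm_le _ _)
  have e2 : ‖H.P k (coX (H.ms k) (T (R x2))) - coX k x‖ ≤ 1 / 4 * ‖x‖ := by
    rw [hx2, trunc_singleton]
    simp only [map_sum, map_smul, H.R_eX R hR]
    have := H.hPx k (coX k x)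
    simp only [map_sum, map_smul] at this
    refine this.trans ?_
    gcongr
    exact coX_norm_le _ _
  have hsplit : H.P k (coX (H.ms k) (T (R x))) - coX k x =
      (H.P k (coX (H.ms k) (T (R x2))) - coX k x) + H.P k (coX (H.ms k) (T (R x1))) +
        H.P k (coX (H.ms k) (T (R x3))) := by
    have : H.P k (coX (H.ms k) (T (R x))) = H.P k (coX (H.ms k) (T (R x1))) +
        H.P k (coX (H.ms k) (T (R x2))) + H.P k (coX (H.ms k) (T (R x3))) := by
      conv_lhs => rw [hx]
      simp only [map_add]
    rw [this]
    abel
  rw [hsplit]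
  refine (norm_add₃_le).trans ?_
  have f1 := (H.hP k (coX (H.ms k) (T (R x1)))).trans (mul_le_mul_of_nonneg_left e1 hK)
  have f3 := (H.hP k (coX (H.ms k) (T (R x3)))).trans (mul_le_mul_of_nonneg_left e3 hK)
  linarith

end Hump

theorem exists_linv {E : Type} [NormedAddCommGroup E] [NormedSpace ℝ E] [CompleteSpace E]
    (U : E →L[ℝ] E) (h : ‖(1 : E →L[ℝ] E) - U‖ < 1) :
    ∃ V : E →L[ℝ] E, V.comp U = ContinuousLinearMap.id ℝ E := by
  have hu : IsUnit U := by
    have := isUnit_one_sub_of_norm_lt_one h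
    rwa [sub_sub_cancel] at this
  exact hu.exists_left_inv

theorem id_factors (T : Xsp →L[ℝ] Xsp) (h : ¬ OB T) :
    ∃ S R : Xsp →L[ℝ] Xsp, S.comp (T.comp R) = ContinuousLinearMap.id ℝ Xsp := by
  obtain ⟨ε, hε, hF⟩ := fails_of_not_OB T h
  obtain ⟨H⟩ := exists_hump T ε hε hF (ε / 16) (by positivity)
  obtain ⟨R, hR, hRn⟩ := H.exists_R
  obtain ⟨S, hS⟩ := H.exists_S
  set U : Xsp →L[ℝ] Xsp := S.comp (T.comp R) with hU
  have hlt : ‖(1 : Xsp →L[ℝ] Xsp) - U‖ < 1 := by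
    refine lt_of_le_of_lt (b := 1 / 2) ?_ (by norm_num)
    refine ContinuousLinearMap.opNorm_le_bound _ (by norm_num) fun x => ?_
    refine X_norm_le (by positivity) fun k => ?_
    have e := H.est (by positivity) (by positivity) R hR hRn k x
    have hc : 1 / 4 + 2 * (2 / ε * (ε / 16)) = 1 / 2 := by field_simp; norm_num
    rw [hc, ← hS k, norm_sub_rev] at e
    have : coX k ((1 - U) x) = coX k x - coX k (S (T (R x))) := by
      rw [← map_sub]; rfl
    rw [this]
    exact e
  obtain ⟨V, hV⟩ := exists_linv U hlt
  exact ⟨V.comp S, R, by rw [ContinuousLinearMap.comp_assoc]; exact hV⟩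

theorem main_proof :
    IsOperatorIdeal SurHull ∧ SurHull ≠ (Set.univ : Set (Xsp →L[ℝ] Xsp)) ∧
    (∀ S : Set (Xsp →L[ℝ] Xsp), IsOperatorIdeal S →
      S ≠ (Set.univ : Set (Xsp →L[ℝ] Xsp)) → S ⊆ SurHull) := by
  refine ⟨surHull_ideal, surHull_proper, fun I hI hne T hT => ?_⟩
  by_contra hcon
  obtain ⟨S, R, hSR⟩ := id_factors T fun hOB => hcon (OB_surHull T hOB)
  apply hne
  have hid : ContinuousLinearMap.id ℝ Xsp ∈ I := by
    rw [← hSR]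
    exact (hI.2.2 _ (hI.2.2 T hT R).2 S).1
  refine Set.eq_univ_of_forall fun V => ?_
  have := (hI.2.2 _ hid V).1
  rwa [ContinuousLinearMap.comp_id] at this

/-- **The surjective hull of `𝒢̄_{c₀}` is the unique maximal ideal of `B(X)`** for
`X = (⊕ₙ ℓ₁ⁿ)_{c₀}`: it is a proper two-sided ideal containing every proper two-sided
ideal of `B(X)`. -/
theorem surjective_hull_unique_maximal_ideal :
    IsOperatorIdeal SurHull ∧ SurHull ≠ (Set.univ : Set (Xsp →L[ℝ] Xsp)) ∧
    (∀ S : Set (Xsp →L[ℝ] Xsp), IsOperatorIdeal S →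
      S ≠ (Set.univ : Set (Xsp →L[ℝ] Xsp)) → S ⊆ SurHull) := by
  exact main_proof

end
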